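/- There exists G ≥ 1 such that for all g ≥ G: the ℚ-vector space of GL(H)-equivariant linear maps C₁₂^{(4)} → Sym⁴H has dimension 6, the space of GL(H)-equivariant linear maps Ω̃₂^{(4)} → Sym⁴H has dimension 2, and the space of GL(H)-equivariant linear maps Ω̃₂^{(4)} → Λ⁴H has dimension 2. (The multiplicities of [4] and [1⁴] in the n = 6 row of Proposition 4.1 of the paper.) -/

import Mathlib

open TensorProduct

set_option maxSynthPendingDepth 4

noncomputable section

/-- The symplectic vector space `H = ℚ^{2g}`. -/
abbrev Hsp (g : ℕ) : Type := Fin (2 * g) → ℚ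

/-- The tensor algebra `T = T(H)`. -/
abbrev TA (g : ℕ) : Type := TensorAlgebra ℚ (Hsp g)

/-- The antipode `x ↦ x̄`, determined by `overline (u₁⋯u_m) = (−1)^m u_m⋯u₁`. -/
def barT (g : ℕ) : TA g →ₗ[ℚ] TA g :=
  (MulOpposite.opLinearEquiv ℚ (M := TA g)).symm.toLinearMap ∘ₗ
    (TensorAlgebra.lift ℚ
      ((MulOpposite.opLinearEquiv ℚ (M := TA g)).toLinearMap ∘ₗ
        (-(TensorAlgebra.ι ℚ (M := Hsp g))))).toLinearMap

/-- The coproduct `Δ : T → T ⊗ T`, the algebra homomorphism with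
`Δ(u) = u ⊗ 1 + 1 ⊗ u` for `u ∈ H`. -/
def comul (g : ℕ) : TA g →ₗ[ℚ] TA g ⊗[ℚ] TA g :=
  (TensorAlgebra.lift ℚ
    (((TensorProduct.mk ℚ (TA g) (TA g)).flip 1) ∘ₗ TensorAlgebra.ι ℚ
      + (TensorProduct.mk ℚ (TA g) (TA g) 1) ∘ₗ TensorAlgebra.ι ℚ)).toLinearMap

/-- `T ⊗ T ⊗ T ⊗ T`. -/
abbrev T4 (g : ℕ) : Type := TA g ⊗[ℚ] (TA g ⊗[ℚ] (TA g ⊗[ℚ] TA g))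

/-- The generator `Θ(t,u,v,w)`, i.e. `t ⊗ u ⊗ v ⊗ w`. -/
def Th (g : ℕ) (t u v w : TA g) : T4 g := t ⊗ₜ[ℚ] (u ⊗ₜ[ℚ] (v ⊗ₜ[ℚ] w))

/-- The second term `Θ(t̄′, t″u, v̄′, wv″)` of the (GC3) relation
(Sweedler summation implicit). -/
def gc3B (g : ℕ) (t u v w : TA g) : T4 g :=
  (TensorProduct.assoc ℚ (TA g) (TA g) (TA g ⊗[ℚ] TA g))
    ((TensorProduct.map (barT g) (LinearMap.mulRight ℚ u)) (comul g t) ⊗ₜ[ℚ]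
     (TensorProduct.map (barT g) (LinearMap.mulLeft ℚ w)) (comul g v))

/-- The third term `Θ(tu″, ū′, w″v, w̄′)` of the (GC3) relation
(Sweedler summation implicit). -/
def gc3C (g : ℕ) (t u v w : TA g) : T4 g :=
  (TensorProduct.assoc ℚ (TA g) (TA g) (TA g ⊗[ℚ] TA g))
    ((TensorProduct.comm ℚ (TA g) (TA g)
        ((TensorProduct.map (barT g) (LinearMap.mulLeft ℚ t)) (comul g u))) ⊗ₜ[ℚ]
     (TensorProduct.comm ℚ (TA g) (TA g)
        ((TensorProduct.map (barT g) (LinearMap.mulRight ℚ v)) (comul g w))))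

/-- The full (GC3) element `Θ(t,u,v,w) + Θ(t̄′,t″u,v̄′,wv″) + Θ(tu″,ū′,w″v,w̄′)`. -/
def gc3 (g : ℕ) (t u v w : TA g) : T4 g :=
  Th g t u v w + gc3B g t u v w + gc3C g t u v w

/-- The relations (CS), (HB) and (GC3) defining `Ω̃₂`. -/
def OmegaRel (g : ℕ) : Set (T4 g) :=
  {x | (∃ t u v w : TA g,
          x = Th g t u v w - Th g (barT g v) (barT g w) (barT g t) (barT g u)) ∨
       (∃ t u v w : TA g,
          x = Th g t u v w - Th g (barT g u) (barT g t) (barT g w) (barT g v)) ∨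
       (∃ (t u v w : TA g) (a : Hsp g),
          x = Th g t u v (w * TensorAlgebra.ι ℚ a)
              - Th g t u (TensorAlgebra.ι ℚ a * v) w
              - Th g t (TensorAlgebra.ι ℚ a * u) v w
              + Th g (t * TensorAlgebra.ι ℚ a) u v w) ∨
       (∃ t u v w : TA g, x = gc3 g t u v w)}

/-- The 2-loop space `Ω̃₂`. -/
abbrev Omega2 (g : ℕ) : Type := T4 g ⧸ Submodule.span ℚ (OmegaRel g)

/-- The class `Θ(t,u,v,w) ∈ Ω̃₂`. -/
def ThO (g : ℕ) (t u v w : TA g) : Omega2 g := Submodule.Quotient.mk (Th g t u v w)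

/-- The presentation space for `C_{1,2}ℋ`: one copy of `T⊗T⊗T⊗T` for the theta
generators and one for the dumbbell generators. -/
abbrev P2 (g : ℕ) : Type := T4 g × T4 g

/-- The theta generator in the presentation space. -/
def ThP (g : ℕ) (t u v w : TA g) : P2 g := (Th g t u v w, 0)

/-- The dumbbell generator in the presentation space. -/
def DP (g : ℕ) (t u v w : TA g) : P2 g := (0, Th g t u v w)

/-- The relations (CS), (HB) and (CC) defining `C₁₂ = C_{1,2}ℋ`. -/
def C12Rel (g : ℕ) : Set (P2 g) :=
  {x | (∃ t u v w : TA g,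
          x = ThP g t u v w - ThP g (barT g v) (barT g w) (barT g t) (barT g u)) ∨
       (∃ t u v w : TA g,
          x = ThP g t u v w - ThP g (barT g u) (barT g t) (barT g w) (barT g v)) ∨
       (∃ t u v w : TA g,
          x = DP g t u v w - DP g (barT g v) u (barT g t) w) ∨
       (∃ t u v w : TA g,
          x = DP g t u v w - DP g (barT g u) (barT g t) (barT g w) (barT g v)) ∨
       (∃ (t u v w : TA g) (a : Hsp g),
          x = ThP g t u v (w * TensorAlgebra.ι ℚ a)
              - ThP g t u (TensorAlgebra.ι ℚ a * v) w
              - ThP g t (TensorAlgebra.ι ℚ a * u) v w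
              + ThP g (t * TensorAlgebra.ι ℚ a) u v w) ∨
       (∃ (t u v w : TA g) (a : Hsp g),
          x = DP g t u (TensorAlgebra.ι ℚ a * v) w
              - DP g (t * TensorAlgebra.ι ℚ a) u v w
              - DP g t u v (w * TensorAlgebra.ι ℚ a)
              + DP g t (TensorAlgebra.ι ℚ a * u) v w) ∨
       (∃ t u v w : TA g,
          x = DP g t u v w - ThP g t u v w - ThP g (barT g v) u (barT g t) w)}

/-- The space `C₁₂ = C_{1,2}ℋ`. -/
abbrev C12 (g : ℕ) : Type := P2 g ⧸ Submodule.span ℚ (C12Rel g)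

/-- The class `Θ(t,u,v,w) ∈ C₁₂`. -/
def ThC (g : ℕ) (t u v w : TA g) : C12 g := Submodule.Quotient.mk (ThP g t u v w)

/-- The class `D(t,u,v,w) ∈ C₁₂`. -/
def DC (g : ℕ) (t u v w : TA g) : C12 g := Submodule.Quotient.mk (DP g t u v w)

/-- The element `GC3(t,u,v,w) ∈ C₁₂`. -/
def gc3C12 (g : ℕ) (t u v w : TA g) : C12 g :=
  Submodule.Quotient.mk ((gc3 g t u v w, 0) : P2 g)

/-- The degree-`n` component `H^{⊗n}` of the tensor algebra. -/
def TAdeg (g n : ℕ) : Submodule ℚ (TA g) :=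
  (LinearMap.range (TensorAlgebra.ι ℚ : Hsp g →ₗ[ℚ] TA g)) ^ n

/-- The part of `T⊗T⊗T⊗T` of total tensor degree `m`. -/
def T4deg (g m : ℕ) : Submodule ℚ (T4 g) :=
  Submodule.span ℚ {x | ∃ i j k l : ℕ, i + j + k + l = m ∧
    ∃ t ∈ TAdeg g i, ∃ u ∈ TAdeg g j, ∃ v ∈ TAdeg g k, ∃ w ∈ TAdeg g l,
      x = Th g t u v w}

/-- The part `Ω̃₂^{(m)}` of total tensor degree `m`. -/
def Omega2deg (g m : ℕ) : Submodule ℚ (Omega2 g) :=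
  Submodule.map (Submodule.span ℚ (OmegaRel g)).mkQ (T4deg g m)

/-- The part `C₁₂^{(m)}` of total tensor degree `m` (Lie degree `n = m + 2`). -/
def C12deg (g m : ℕ) : Submodule ℚ (C12 g) :=
  Submodule.map (Submodule.span ℚ (C12Rel g)).mkQ ((T4deg g m).prod (T4deg g m))

/-- The functorial action of a linear endomorphism of `H` on the tensor algebra. -/
def TAmap (g : ℕ) (φ : Hsp g →ₗ[ℚ] Hsp g) : TA g →ₐ[ℚ] TA g :=
  TensorAlgebra.lift ℚ (TensorAlgebra.ι ℚ ∘ₗ φ)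

/-- The diagonal action on `T⊗T⊗T⊗T`. -/
def T4map (g : ℕ) (φ : Hsp g →ₗ[ℚ] Hsp g) : T4 g →ₗ[ℚ] T4 g :=
  TensorProduct.map (TAmap g φ).toLinearMap
    (TensorProduct.map (TAmap g φ).toLinearMap
      (TensorProduct.map (TAmap g φ).toLinearMap (TAmap g φ).toLinearMap))

/-- The diagonal action on the presentation space of `C₁₂`. -/
def P2map (g : ℕ) (φ : Hsp g →ₗ[ℚ] Hsp g) : P2 g →ₗ[ℚ] P2 g :=
  (T4map g φ).prodMap (T4map g φ)

/-- The action of `GL(H)` on polynomials, realizing `MvPolynomial (Fin 2g) ℚ` as the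
symmetric algebra `Sym H` via `eᵢ ↦ Xᵢ`. -/
def polyAct (g : ℕ) (σ : Hsp g ≃ₗ[ℚ] Hsp g) :
    MvPolynomial (Fin (2 * g)) ℚ →ₐ[ℚ] MvPolynomial (Fin (2 * g)) ℚ :=
  MvPolynomial.aeval fun i => ∑ j, MvPolynomial.C (σ (Pi.single i 1) j) * MvPolynomial.X j

/-- The `m`-th symmetric power `Sym^m H`, realized as the homogeneous polynomials of
degree `m`. -/
abbrev SymP (g m : ℕ) : Type := ↥(MvPolynomial.homogeneousSubmodule (Fin (2 * g)) ℚ m)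

/-- The space of `GL(H)`-equivariant linear maps `C₁₂^{(m)} → Λ^n H`. -/
def equivC12toLam (g m n : ℕ) :
    Submodule ℚ (↥(C12deg g m) →ₗ[ℚ] ↥(⋀[ℚ]^n (Hsp g))) where
  carrier := {π | ∀ (σ : Hsp g ≃ₗ[ℚ] Hsp g) (p : P2 g)
      (hx : Submodule.Quotient.mk p ∈ C12deg g m)
      (hy : Submodule.Quotient.mk (P2map g σ.toLinearMap p) ∈ C12deg g m),
      (↑(π ⟨Submodule.Quotient.mk (P2map g σ.toLinearMap p), hy⟩) :
          ExteriorAlgebra ℚ (Hsp g))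
        = ExteriorAlgebra.map σ.toLinearMap
            ↑(π ⟨Submodule.Quotient.mk p, hx⟩)}
  add_mem' := by
    intro f₁ f₂ h₁ h₂ σ p hx hy
    simp only [LinearMap.add_apply, Submodule.coe_add, h₁ σ p hx hy, h₂ σ p hx hy, map_add]
  zero_mem' := by
    intro σ p hx hy
    simp
  smul_mem' := by
    intro c f h σ p hx hy
    simp only [LinearMap.smul_apply, SetLike.val_smul, h σ p hx hy, map_smul]

/-- The space of `GL(H)`-equivariant linear maps `Ω̃₂^{(m)} → Λ^n H`. -/
def equivOmega2toLam (g m n : ℕ) :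
    Submodule ℚ (↥(Omega2deg g m) →ₗ[ℚ] ↥(⋀[ℚ]^n (Hsp g))) where
  carrier := {π | ∀ (σ : Hsp g ≃ₗ[ℚ] Hsp g) (x : T4 g)
      (hx : Submodule.Quotient.mk x ∈ Omega2deg g m)
      (hy : Submodule.Quotient.mk (T4map g σ.toLinearMap x) ∈ Omega2deg g m),
      (↑(π ⟨Submodule.Quotient.mk (T4map g σ.toLinearMap x), hy⟩) :
          ExteriorAlgebra ℚ (Hsp g))
        = ExteriorAlgebra.map σ.toLinearMap
            ↑(π ⟨Submodule.Quotient.mk x, hx⟩)}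
  add_mem' := by
    intro f₁ f₂ h₁ h₂ σ p hx hy
    simp only [LinearMap.add_apply, Submodule.coe_add, h₁ σ p hx hy, h₂ σ p hx hy, map_add]
  zero_mem' := by
    intro σ p hx hy
    simp
  smul_mem' := by
    intro c f h σ p hx hy
    simp only [LinearMap.smul_apply, SetLike.val_smul, h σ p hx hy, map_smul]

/-- The space of `GL(H)`-equivariant linear maps `C₁₂^{(m)} → Sym^n H`. -/
def equivC12toSym (g m n : ℕ) :
    Submodule ℚ (↥(C12deg g m) →ₗ[ℚ] SymP g n) where
  carrier := {π | ∀ (σ : Hsp g ≃ₗ[ℚ] Hsp g) (p : P2 g)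
      (hx : Submodule.Quotient.mk p ∈ C12deg g m)
      (hy : Submodule.Quotient.mk (P2map g σ.toLinearMap p) ∈ C12deg g m),
      (↑(π ⟨Submodule.Quotient.mk (P2map g σ.toLinearMap p), hy⟩) :
          MvPolynomial (Fin (2 * g)) ℚ)
        = polyAct g σ ↑(π ⟨Submodule.Quotient.mk p, hx⟩)}
  add_mem' := by
    intro f₁ f₂ h₁ h₂ σ p hx hy
    simp only [LinearMap.add_apply, Submodule.coe_add, h₁ σ p hx hy, h₂ σ p hx hy, map_add]
  zero_mem' := by
    intro σ p hx hy
    simp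
  smul_mem' := by
    intro c f h σ p hx hy
    simp only [LinearMap.smul_apply, SetLike.val_smul, h σ p hx hy, map_smul]

/-- The space of `GL(H)`-equivariant linear maps `Ω̃₂^{(m)} → Sym^n H`. -/
def equivOmega2toSym (g m n : ℕ) :
    Submodule ℚ (↥(Omega2deg g m) →ₗ[ℚ] SymP g n) where
  carrier := {π | ∀ (σ : Hsp g ≃ₗ[ℚ] Hsp g) (x : T4 g)
      (hx : Submodule.Quotient.mk x ∈ Omega2deg g m)
      (hy : Submodule.Quotient.mk (T4map g σ.toLinearMap x) ∈ Omega2deg g m),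
      (↑(π ⟨Submodule.Quotient.mk (T4map g σ.toLinearMap x), hy⟩) :
          MvPolynomial (Fin (2 * g)) ℚ)
        = polyAct g σ ↑(π ⟨Submodule.Quotient.mk x, hx⟩)}
  add_mem' := by
    intro f₁ f₂ h₁ h₂ σ p hx hy
    simp only [LinearMap.add_apply, Submodule.coe_add, h₁ σ p hx hy, h₂ σ p hx hy, map_add]
  zero_mem' := by
    intro σ p hx hy
    simp
  smul_mem' := by
    intro c f h σ p hx hy
    simp only [LinearMap.smul_apply, SetLike.val_smul, h σ p hx hy, map_smul]

/-! ### Words in the tensor algebra -/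

/-- The word `u₁⋯u_m` in the tensor algebra attached to a list of vectors. -/
def word {g : ℕ} (L : List (Hsp g)) : TA g := (L.map (TensorAlgebra.ι ℚ)).prod

@[simp] lemma word_nil {g : ℕ} : word ([] : List (Hsp g)) = 1 := rfl

@[simp] lemma word_cons {g : ℕ} (a : Hsp g) (L : List (Hsp g)) :
    word (a :: L) = TensorAlgebra.ι ℚ a * word L := by simp [word]

lemma word_append {g : ℕ} (L L' : List (Hsp g)) : word (L ++ L') = word L * word L' := by
  simp [word]

lemma word_mul_ι {g : ℕ} (L : List (Hsp g)) (a : Hsp g) :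
    word L * TensorAlgebra.ι ℚ a = word (L ++ [a]) := by
  simp [word_append]

lemma word_mem_TAdeg {g : ℕ} (L : List (Hsp g)) : word L ∈ TAdeg g L.length := by
  induction L with
  | nil => simp [TAdeg]
  | cons a L ih =>
    rw [word_cons, List.length_cons, TAdeg, pow_succ']
    exact Submodule.mul_mem_mul ⟨a, rfl⟩ ih

lemma pow_range_le_span {V A : Type*} [AddCommGroup V] [Module ℚ V] [Ring A] [Algebra ℚ A]
    (f : V →ₗ[ℚ] A) (s : Set V) (hs : Submodule.span ℚ s = ⊤) (n : ℕ) :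
    (LinearMap.range f) ^ n ≤
      Submodule.span ℚ {x | ∃ v : Fin n → V, (∀ p, v p ∈ s) ∧
        x = (List.ofFn fun p => f (v p)).prod} := by
  rw [LinearMap.range_eq_map, ← hs, Submodule.map_span, Submodule.span_pow]
  refine Submodule.span_mono fun x hx => ?_
  obtain ⟨m, rfl⟩ := Set.mem_pow.1 hx
  choose v hv using fun p => (m p).2
  exact ⟨v, fun p => (hv p).1, by simp only [hv]⟩

lemma TAdeg_le_span_word (g n : ℕ) :
    TAdeg g n ≤ Submodule.span ℚ {x | ∃ L : List (Hsp g), L.length = n ∧ x = word L} := by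
  refine (pow_range_le_span _ Set.univ Submodule.span_univ n).trans (Submodule.span_mono ?_)
  rintro _ ⟨v, -, rfl⟩
  exact ⟨List.ofFn v, by simp, by simp [word, List.map_ofFn, Function.comp_def]⟩

lemma span_word_eq_top (g : ℕ) : Submodule.span ℚ (Set.range (word (g := g))) = ⊤ := by
  rw [eq_top_iff]
  rintro x -
  induction x using TensorAlgebra.induction with
  | algebraMap r =>
    rw [Algebra.algebraMap_eq_smul_one]
    exact Submodule.smul_mem _ _ (Submodule.subset_span ⟨[], rfl⟩)
  | ι a => exact Submodule.subset_span ⟨[a], by simp⟩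
  | add a b ha hb => exact Submodule.add_mem _ ha hb
  | mul a b ha hb =>
    refine Submodule.span_le.2 ?_ ((Submodule.span_mul_span ℚ _ _).le (Submodule.mul_mem_mul ha hb))
    rintro _ ⟨_, ⟨L, rfl⟩, _, ⟨L', rfl⟩, rfl⟩
    exact Submodule.subset_span ⟨L ++ L', word_append L L'⟩

/-- The function `f` is linear in each of its four arguments. -/
structure IsLinear₄ {g : ℕ} {V : Type*} [AddCommGroup V] [Module ℚ V]
    (f : TA g → TA g → TA g → TA g → V) : Prop where
  fst : ∀ u v w, IsLinearMap ℚ fun t => f t u v w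
  snd : ∀ t v w, IsLinearMap ℚ fun u => f t u v w
  trd : ∀ t u w, IsLinearMap ℚ fun v => f t u v w
  fth : ∀ t u v, IsLinearMap ℚ fun w => f t u v w

lemma IsLinearMap.eq_zero_of_mem_span {V W : Type*} [AddCommGroup V] [Module ℚ V]
    [AddCommGroup W] [Module ℚ W] {f : V → W} (hf : IsLinearMap ℚ f) {s : Set V}
    (h : ∀ x ∈ s, f x = 0) {x : V} (hx : x ∈ Submodule.span ℚ s) : f x = 0 :=
  LinearMap.eqOn_span (f := hf.mk' f) (g := 0) h hx

lemma IsLinear₄.eq_zero_of_mem_span {g : ℕ} {V : Type*} [AddCommGroup V] [Module ℚ V]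
    {f : TA g → TA g → TA g → TA g → V} (hf : IsLinear₄ f) {s₁ s₂ s₃ s₄ : Set (TA g)}
    (h : ∀ t ∈ s₁, ∀ u ∈ s₂, ∀ v ∈ s₃, ∀ w ∈ s₄, f t u v w = 0)
    {t u v w : TA g} (ht : t ∈ Submodule.span ℚ s₁) (hu : u ∈ Submodule.span ℚ s₂)
    (hv : v ∈ Submodule.span ℚ s₃) (hw : w ∈ Submodule.span ℚ s₄) : f t u v w = 0 :=
  (hf.fst u v w).eq_zero_of_mem_span (fun t ht => (hf.snd t v w).eq_zero_of_mem_span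
    (fun u hu => (hf.trd t u w).eq_zero_of_mem_span (fun v hv =>
      (hf.fth t u v).eq_zero_of_mem_span (h t ht u hu v hv) hw) hv) hu) ht

lemma IsLinear₄.eq_zero_of_word {g : ℕ} {V : Type*} [AddCommGroup V] [Module ℚ V]
    {f : TA g → TA g → TA g → TA g → V} (hf : IsLinear₄ f)
    (h : ∀ L₁ L₂ L₃ L₄, f (word L₁) (word L₂) (word L₃) (word L₄) = 0) (t u v w : TA g) :
    f t u v w = 0 := by
  refine hf.eq_zero_of_mem_span (s₁ := Set.range word) (s₂ := Set.range word)
    (s₃ := Set.range word) (s₄ := Set.range word) ?_ ?_ ?_ ?_ ?_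
  · rintro _ ⟨L₁, rfl⟩ _ ⟨L₂, rfl⟩ _ ⟨L₃, rfl⟩ _ ⟨L₄, rfl⟩
    exact h L₁ L₂ L₃ L₄
  all_goals simp [span_word_eq_top]

lemma isLinear₄_map_Th {g : ℕ} {V : Type*} [AddCommGroup V] [Module ℚ V] (φ : T4 g →ₗ[ℚ] V) :
    IsLinear₄ fun t u v w => φ (Th g t u v w) := by
  constructor <;> intros <;> constructor <;> intros <;>
    simp only [Th, TensorProduct.tmul_add, TensorProduct.add_tmul, TensorProduct.tmul_smul,
      ← TensorProduct.smul_tmul', map_add, map_smul]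

/-! ### Antipode and coproduct of words -/

lemma barT_one (g : ℕ) : barT g 1 = 1 := by simp [barT]

lemma barT_ι_mul {g : ℕ} (a : Hsp g) (x : TA g) :
    barT g (TensorAlgebra.ι ℚ a * x) = -(barT g x * TensorAlgebra.ι ℚ a) := by
  simp [barT]

lemma barT_word {g : ℕ} (L : List (Hsp g)) :
    barT g (word L) = (-1 : ℚ) ^ L.length • word L.reverse := by
  induction L with
  | nil => simp [barT_one]
  | cons a L ih =>
    rw [word_cons, barT_ι_mul, ih, List.reverse_cons, ← word_mul_ι, List.length_cons, pow_succ]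
    simp

/-- All ways to split a list into two complementary subsequences. -/
def splits {α : Type*} : List α → List (List α × List α)
  | [] => [([], [])]
  | a :: L => (splits L).map (fun P => (a :: P.1, P.2)) ++
      (splits L).map (fun P => (P.1, a :: P.2))

lemma comul_one (g : ℕ) : comul g 1 = 1 ⊗ₜ 1 := by
  simp [comul, Algebra.TensorProduct.one_def]

lemma comul_ι_mul {g : ℕ} (a : Hsp g) (x : TA g) :
    comul g (TensorAlgebra.ι ℚ a * x) =
      (TensorAlgebra.ι ℚ a ⊗ₜ[ℚ] 1 + 1 ⊗ₜ[ℚ] TensorAlgebra.ι ℚ a) * comul g x := by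
  simp [comul]

lemma comul_word {g : ℕ} (L : List (Hsp g)) :
    comul g (word L) = ((splits L).map fun P => word P.1 ⊗ₜ[ℚ] word P.2).sum := by
  induction L with
  | nil => simp [splits, comul_one]
  | cons a L ih =>
    rw [word_cons, comul_ι_mul, ih, splits, List.map_append, List.sum_append, List.map_map,
      List.map_map, add_mul, ← List.sum_map_mul_left, ← List.sum_map_mul_left]
    simp [Function.comp_def]

/-! ### Numerical form of the relations

For an algebra in which generators commute up to the sign `ε`, the value of a linear form on a
relation between words is a multiple of the product of all the letters; the functions below
compute the multiple from the lengths of the words. -/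

/-- The sign relating a word of length `m` and its antipode. -/
def antipodeSign (ε : ℚ) : ℕ → ℚ
  | 0 => 1
  | m + 1 => -ε ^ m * antipodeSign ε m

/-- The sum of `f |P| |Q|` over all splittings `(P, Q)` of a word of length `m`, weighted by the
sign of the corresponding unshuffle. -/
def unshuffleSum (ε : ℚ) : (ℕ → ℕ → ℚ) → ℕ → ℚ
  | f, 0 => f 0 0
  | f, m + 1 => unshuffleSum ε (fun r q => f (r + 1) q + ε ^ r * f r (q + 1)) m

lemma unshuffleSum_eq_zero (ε : ℚ) (m : ℕ) (f : ℕ → ℕ → ℚ)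
    (hf : ∀ r q, r + q = m → f r q = 0) : unshuffleSum ε f m = 0 := by
  induction m generalizing f with
  | zero => exact hf 0 0 rfl
  | succ m ih =>
    refine ih _ fun r q h => ?_
    rw [hf (r + 1) q (by omega), hf r (q + 1) (by omega)]
    ring

/-- Coefficient systems indexed by the lengths of the four slots. -/
abbrev Coef : Type := ℕ → ℕ → ℕ → ℕ → ℚ

/-- The coefficients vanish outside total degree four. -/
def Coef.Supported (c : Coef) : Prop := ∀ i j k l, i + j + k + l ≠ 4 → c i j k l = 0

/-- The first chord symmetry of theta graphs. -/
def Coef.thetaFlip (ε : ℚ) (c : Coef) (i j k l : ℕ) : ℚ :=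
  c i j k l - antipodeSign ε i * antipodeSign ε j * antipodeSign ε k * antipodeSign ε l *
    ε ^ ((i + j) * (k + l)) * c k l i j

/-- The second chord symmetry of theta graphs, shared by dumbbells. -/
def Coef.swap (ε : ℚ) (c : Coef) (i j k l : ℕ) : ℚ :=
  c i j k l - antipodeSign ε i * antipodeSign ε j * antipodeSign ε k * antipodeSign ε l *
    ε ^ (i * j + k * l) * c j i l k

/-- The hair balancing relation, with an extra letter to be distributed. -/
def Coef.balance (ε : ℚ) (c : Coef) (i j k l : ℕ) : ℚ :=
  c i j k (l + 1) - ε ^ (k + l) * c i j (k + 1) l - ε ^ (j + k + l) * c i (j + 1) k l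
    + ε ^ (j + k + l) * c (i + 1) j k l

/-- Exchange of the first and third slots, up to antipodes. -/
def Coef.cross (ε : ℚ) (c : Coef) (i j k l : ℕ) : ℚ :=
  antipodeSign ε i * antipodeSign ε k * ε ^ (k * (i + j) + i * j) * c k j i l

/-- The coefficient of the second term of the (GC3) relation. -/
def Coef.unshuffleB (ε : ℚ) (c : Coef) (i j k l : ℕ) : ℚ :=
  unshuffleSum ε (fun r q => antipodeSign ε r *
    unshuffleSum ε (fun r' q' => antipodeSign ε r' * ε ^ (l * q') * c r (q + j) r' (l + q')) k) i

/-- The coefficient of the third term of the (GC3) relation. -/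
def Coef.unshuffleC (ε : ℚ) (c : Coef) (i j k l : ℕ) : ℚ :=
  unshuffleSum ε (fun r q => antipodeSign ε r * ε ^ (q * r) *
    unshuffleSum ε (fun r' q' => antipodeSign ε r' * ε ^ (q' * k + q' * r') *
      c (i + q) r (q' + k) r') l) j

/-! ### Linear forms on `T⊗T⊗T⊗T` given by coefficients -/

/-- An algebra generated by `H` with generators commuting up to the sign `ε`, with an action of
`GL(H)`: a common framework for the symmetric and the exterior algebra. -/
structure SignedModel (g : ℕ) (A : Type) [Ring A] [Algebra ℚ A] where
  /-- the commutation sign -/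
  ε : ℚ
  /-- the inclusion of the generators -/
  ℓ : Hsp g →ₗ[ℚ] A
  /-- the action of `GL(H)` -/
  act : (Hsp g ≃ₗ[ℚ] Hsp g) → A →ₐ[ℚ] A
  sq_ε : ε * ε = 1
  comm : ∀ x y, ℓ x * ℓ y = ε • (ℓ y * ℓ x)
  act_ℓ : ∀ σ x, act σ (ℓ x) = ℓ (σ x)

namespace SignedModel

variable {g : ℕ} {A : Type} [Ring A] [Algebra ℚ A] (S : SignedModel g A)

/-- The image of a word in the model algebra. -/
def val (L : List (Hsp g)) : A := (L.map S.ℓ).prod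

@[simp] lemma val_nil : S.val [] = 1 := rfl

@[simp] lemma val_cons (a : Hsp g) (L : List (Hsp g)) : S.val (a :: L) = S.ℓ a * S.val L := by
  simp [val]

@[simp] lemma val_append (L L' : List (Hsp g)) : S.val (L ++ L') = S.val L * S.val L' := by
  simp [val]

lemma ℓ_mul_val (a : Hsp g) (L : List (Hsp g)) :
    S.ℓ a * S.val L = S.ε ^ L.length • (S.val L * S.ℓ a) := by
  induction L with
  | nil => simp
  | cons b L ih =>
    rw [val_cons, ← mul_assoc, S.comm, smul_mul_assoc, mul_assoc, ih, mul_smul_comm, smul_smul,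
      List.length_cons, pow_succ', mul_assoc]

lemma val_mul_val (L L' : List (Hsp g)) :
    S.val L * S.val L' = S.ε ^ (L.length * L'.length) • (S.val L' * S.val L) := by
  induction L with
  | nil => simp
  | cons a L ih =>
    rw [val_cons, mul_assoc, ih, mul_smul_comm, ← mul_assoc, ℓ_mul_val, smul_mul_assoc, smul_smul,
      List.length_cons, mul_assoc]
    congr 1
    ring

lemma val_mul_val_mul (L L' : List (Hsp g)) (x : A) :
    S.val L * (S.val L' * x) = S.ε ^ (L.length * L'.length) • (S.val L' * (S.val L * x)) := by
  rw [← mul_assoc, val_mul_val, smul_mul_assoc, mul_assoc]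

lemma val_reverse (L : List (Hsp g)) :
    (-1 : ℚ) ^ L.length • S.val L.reverse = antipodeSign S.ε L.length • S.val L := by
  induction L with
  | nil => simp [antipodeSign]
  | cons a L ih =>
    have h : ∀ c : ℚ, c • (S.val L.reverse * S.ℓ a) = (c • S.val L.reverse) * S.ℓ a :=
      fun c => (smul_mul_assoc _ _ _).symm
    rw [List.reverse_cons, val_append, List.length_cons, pow_succ', mul_smul, val_cons, val_cons,
      val_nil, mul_one, h, ih, ℓ_mul_val, smul_smul, antipodeSign, smul_mul_assoc, smul_smul]
    congr 1
    have : S.ε ^ L.length * S.ε ^ L.length = 1 := by rw [← mul_pow, S.sq_ε, one_pow]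
    linear_combination (antipodeSign S.ε L.length) * this

lemma sum_splits_val (L : List (Hsp g)) (f : ℕ → ℕ → ℚ) :
    ((splits L).map fun P => f P.1.length P.2.length • (S.val P.1 * S.val P.2)).sum =
      unshuffleSum S.ε f L.length • S.val L := by
  induction L generalizing f with
  | nil => simp [splits, unshuffleSum]
  | cons a L ih =>
    rw [List.length_cons, unshuffleSum, val_cons, ← mul_smul_comm, ← ih, ← List.sum_map_mul_left,
      splits, List.map_append, List.sum_append, List.map_map, List.map_map, ← List.sum_map_add]
    congr 1
    refine List.map_congr_left fun P _ => ?_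
    have h : S.val P.1 * (S.ℓ a * S.val P.2) =
        S.ε ^ P.1.length • (S.ℓ a * (S.val P.1 * S.val P.2)) := by
      simpa using S.val_mul_val_mul P.1 [a] (S.val P.2)
    simp only [Function.comp_def, val_cons, List.length_cons, mul_assoc, h, smul_smul, add_smul,
      mul_comm (f P.1.length (P.2.length + 1)), mul_add, mul_smul_comm]

/-- The component of degree `n` of the algebra homomorphism `T(H) → A`. -/
def component (n : ℕ) : TA g →ₗ[ℚ] A :=
  (Polynomial.lcoeff A n).restrictScalars ℚ ∘ₗ
    (TensorAlgebra.lift ℚ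
      (((LinearMap.mulRight ℚ (Polynomial.X : Polynomial A)) ∘ₗ
        (Polynomial.CAlgHom (R := ℚ) (A := A)).toLinearMap) ∘ₗ S.ℓ)).toLinearMap

/-- The tensor `t` has its only nonzero component in degree `m`, with value `x`. -/
def IsPure (t : TA g) (m : ℕ) (x : A) : Prop :=
  ∀ n, S.component n t = if n = m then x else 0

lemma isPure_word (L : List (Hsp g)) : S.IsPure (word L) L.length (S.val L) := by
  intro n
  have h : TensorAlgebra.lift ℚ
      (((LinearMap.mulRight ℚ (Polynomial.X : Polynomial A)) ∘ₗ
        (Polynomial.CAlgHom (R := ℚ) (A := A)).toLinearMap) ∘ₗ S.ℓ) (word L) =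
      Polynomial.C (S.val L) * Polynomial.X ^ L.length := by
    induction L with
    | nil => simp
    | cons a L ih =>
      rw [word_cons, map_mul, ih]
      simp only [TensorAlgebra.lift_ι_apply, LinearMap.comp_apply, LinearMap.mulRight_apply,
        AlgHom.toLinearMap_apply, Polynomial.CAlgHom_apply, val_cons, List.length_cons, map_mul,
        mul_assoc]
      rw [← mul_assoc Polynomial.X, Polynomial.X_mul_C, mul_assoc, ← pow_succ']
  simp [component, h, Polynomial.coeff_C_mul, Polynomial.coeff_X_pow]

lemma isPure_barT_word (L : List (Hsp g)) :
    S.IsPure (barT g (word L)) L.length (antipodeSign S.ε L.length • S.val L) := by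
  intro n
  rw [barT_word, map_smul, S.isPure_word L.reverse n, List.length_reverse, smul_ite, smul_zero,
    val_reverse]

/-- The linear form on `T⊗T⊗T⊗T` with the given coefficients. -/
def form : Coef →ₗ[ℚ] T4 g →ₗ[ℚ] A where
  toFun c := ∑ i ∈ Finset.range 5, ∑ j ∈ Finset.range 5, ∑ k ∈ Finset.range 5,
    ∑ l ∈ Finset.range 5, c i j k l •
      (LinearMap.mul' ℚ A ∘ₗ TensorProduct.map (S.component i)
        (LinearMap.mul' ℚ A ∘ₗ TensorProduct.map (S.component j)
          (LinearMap.mul' ℚ A ∘ₗ TensorProduct.map (S.component k) (S.component l))))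
  map_add' c d := by simp only [Pi.add_apply, add_smul, Finset.sum_add_distrib]
  map_smul' r c := by
    simp only [Pi.smul_apply, smul_eq_mul, mul_smul, Finset.smul_sum, RingHom.id_apply]

variable {c : Coef}

lemma form_pure (hc : c.Supported) {t u v w : TA g} {m₁ m₂ m₃ m₄ : ℕ} {x₁ x₂ x₃ x₄ : A}
    (ht : S.IsPure t m₁ x₁) (hu : S.IsPure u m₂ x₂) (hv : S.IsPure v m₃ x₃)
    (hw : S.IsPure w m₄ x₄) :
    S.form c (Th g t u v w) = c m₁ m₂ m₃ m₄ • (x₁ * (x₂ * (x₃ * x₄))) := by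
  by_cases h : m₁ + m₂ + m₃ + m₄ = 4
  · have h₁ : m₁ < 5 := by omega
    have h₂ : m₂ < 5 := by omega
    have h₃ : m₃ < 5 := by omega
    have h₄ : m₄ < 5 := by omega
    simp only [form, Th, LinearMap.coe_mk, AddHom.coe_mk, LinearMap.sum_apply,
      LinearMap.smul_apply, LinearMap.comp_apply, TensorProduct.map_tmul, LinearMap.mul'_apply,
      ht _, hu _, hv _, hw _, mul_ite, ite_mul, zero_mul, mul_zero, smul_ite, smul_zero,
      Finset.sum_ite_eq', Finset.mem_range, h₁, h₂, h₃, h₄, if_true]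
  · rw [hc _ _ _ _ h, zero_smul]
    simp only [form, Th, LinearMap.coe_mk, AddHom.coe_mk, LinearMap.sum_apply,
      LinearMap.smul_apply, LinearMap.comp_apply, TensorProduct.map_tmul, LinearMap.mul'_apply,
      ht _, hu _, hv _, hw _]
    refine Finset.sum_eq_zero fun i _ => Finset.sum_eq_zero fun j _ =>
      Finset.sum_eq_zero fun k _ => Finset.sum_eq_zero fun l _ => ?_
    split_ifs with h₁ h₂ h₃ h₄
    · subst h₁ h₂ h₃ h₄
      rw [hc _ _ _ _ h, zero_smul]
    all_goals simp only [mul_zero, zero_mul, smul_zero]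

end SignedModel

lemma tmul_list_sum {V W α β : Type*} [AddCommGroup V] [Module ℚ V] [AddCommGroup W] [Module ℚ W]
    (l : List α) (l' : List β) (f : α → V) (f' : β → W) :
    (l.map f).sum ⊗ₜ[ℚ] (l'.map f').sum =
      (l.map fun p => (l'.map fun q => f p ⊗ₜ[ℚ] f' q).sum).sum := by
  have h : ∀ x : V, x ⊗ₜ[ℚ] (l'.map f').sum = (l'.map fun q => x ⊗ₜ[ℚ] f' q).sum := fun x => by
    induction l' with
    | nil => simp
    | cons b l' ih => simp [TensorProduct.tmul_add, ih]
  induction l with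
  | nil => simp
  | cons a l ih => rw [List.map_cons, List.sum_cons, TensorProduct.add_tmul, ih, h]; simp

lemma gc3B_word {g : ℕ} (L₁ L₂ L₃ L₄ : List (Hsp g)) :
    gc3B g (word L₁) (word L₂) (word L₃) (word L₄) =
      ((splits L₁).map fun P => ((splits L₃).map fun Q =>
        Th g (barT g (word P.1)) (word (P.2 ++ L₂)) (barT g (word Q.1))
          (word (L₄ ++ Q.2))).sum).sum := by
  simp only [gc3B, comul_word, map_list_sum, List.map_map, tmul_list_sum, Function.comp_def,
    TensorProduct.map_tmul, TensorProduct.assoc_tmul, LinearMap.mulRight_apply,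
    LinearMap.mulLeft_apply, word_append, Th]

lemma gc3C_word {g : ℕ} (L₁ L₂ L₃ L₄ : List (Hsp g)) :
    gc3C g (word L₁) (word L₂) (word L₃) (word L₄) =
      ((splits L₂).map fun P => ((splits L₄).map fun Q =>
        Th g (word (L₁ ++ P.2)) (barT g (word P.1)) (word (Q.2 ++ L₃))
          (barT g (word Q.1))).sum).sum := by
  simp only [gc3C, comul_word, map_list_sum, List.map_map, tmul_list_sum, Function.comp_def,
    TensorProduct.map_tmul, TensorProduct.comm_tmul, TensorProduct.assoc_tmul,
    LinearMap.mulRight_apply, LinearMap.mulLeft_apply, word_append, Th]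

namespace SignedModel

variable {g : ℕ} {A : Type} [Ring A] [Algebra ℚ A] (S : SignedModel g A) {c : Coef}

/-- The product of the letters of four words. -/
def val₄ (L₁ L₂ L₃ L₄ : List (Hsp g)) : A := S.val L₁ * (S.val L₂ * (S.val L₃ * S.val L₄))

lemma form_word (hc : c.Supported) (L₁ L₂ L₃ L₄ : List (Hsp g)) :
    S.form c (Th g (word L₁) (word L₂) (word L₃) (word L₄)) =
      c L₁.length L₂.length L₃.length L₄.length • S.val₄ L₁ L₂ L₃ L₄ :=
  S.form_pure hc (S.isPure_word _) (S.isPure_word _) (S.isPure_word _) (S.isPure_word _)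

lemma form_thetaFlip (hc : c.Supported) (L₁ L₂ L₃ L₄ : List (Hsp g)) :
    S.form c (Th g (word L₁) (word L₂) (word L₃) (word L₄) -
        Th g (barT g (word L₃)) (barT g (word L₄)) (barT g (word L₁)) (barT g (word L₂))) =
      c.thetaFlip S.ε L₁.length L₂.length L₃.length L₄.length • S.val₄ L₁ L₂ L₃ L₄ := by
  have h := S.val_mul_val (L₃ ++ L₄) (L₁ ++ L₂)
  simp only [val_append, List.length_append, mul_assoc] at h
  rw [map_sub, form_word S hc, S.form_pure hc (S.isPure_barT_word _) (S.isPure_barT_word _)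
    (S.isPure_barT_word _) (S.isPure_barT_word _)]
  simp only [smul_mul_assoc, mul_smul_comm, smul_smul, h, val₄, Coef.thetaFlip, sub_smul]
  congr 2
  ring

lemma form_swap (hc : c.Supported) (L₁ L₂ L₃ L₄ : List (Hsp g)) :
    S.form c (Th g (word L₁) (word L₂) (word L₃) (word L₄) -
        Th g (barT g (word L₂)) (barT g (word L₁)) (barT g (word L₄)) (barT g (word L₃))) =
      c.swap S.ε L₁.length L₂.length L₃.length L₄.length • S.val₄ L₁ L₂ L₃ L₄ := by
  rw [map_sub, form_word S hc, S.form_pure hc (S.isPure_barT_word _) (S.isPure_barT_word _)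
    (S.isPure_barT_word _) (S.isPure_barT_word _)]
  simp only [smul_mul_assoc, mul_smul_comm, smul_smul, S.val_mul_val_mul L₂ L₁,
    S.val_mul_val L₄ L₃, val₄, Coef.swap, sub_smul]
  congr 2
  ring

lemma form_cross (hc : c.Supported) (L₁ L₂ L₃ L₄ : List (Hsp g)) :
    S.form c (Th g (barT g (word L₃)) (word L₂) (barT g (word L₁)) (word L₄)) =
      c.cross S.ε L₁.length L₂.length L₃.length L₄.length • S.val₄ L₁ L₂ L₃ L₄ := by
  rw [S.form_pure hc (S.isPure_barT_word _) (S.isPure_word _)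
    (S.isPure_barT_word _) (S.isPure_word _)]
  simp only [smul_mul_assoc, mul_smul_comm, smul_smul, S.val_mul_val_mul L₂ L₁,
    S.val_mul_val_mul L₃ L₁, S.val_mul_val_mul L₃ L₂, val₄, Coef.cross]
  congr 1
  ring

lemma form_balance (hc : c.Supported) (L₁ L₂ L₃ L₄ : List (Hsp g)) (a : Hsp g) :
    S.form c (Th g (word L₁) (word L₂) (word L₃) (word L₄ * TensorAlgebra.ι ℚ a)
        - Th g (word L₁) (word L₂) (TensorAlgebra.ι ℚ a * word L₃) (word L₄)
        - Th g (word L₁) (TensorAlgebra.ι ℚ a * word L₂) (word L₃) (word L₄)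
        + Th g (word L₁ * TensorAlgebra.ι ℚ a) (word L₂) (word L₃) (word L₄)) =
      c.balance S.ε L₁.length L₂.length L₃.length L₄.length •
        S.val₄ L₁ L₂ L₃ (L₄ ++ [a]) := by
  have h₂ := S.ℓ_mul_val a (L₂ ++ L₃ ++ L₄)
  have h₃ := S.ℓ_mul_val a (L₃ ++ L₄)
  simp only [val_append, List.length_append, mul_assoc] at h₂ h₃
  simp only [word_mul_ι, ← word_cons, map_sub, map_add, form_word S hc, val₄, val_cons,
    val_append, val_nil, mul_one, mul_assoc, List.length_append, List.length_cons,
    List.length_nil, zero_add, h₂, h₃, mul_smul_comm, smul_smul, Coef.balance, sub_smul, add_smul]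
  congr 2
  · congr 2
    ring
  · congr 1
    ring
  · ring

lemma sum_splits_map (φ : A →ₗ[ℚ] A) (L : List (Hsp g)) (r : ℚ) (f : ℕ → ℕ → ℚ) :
    ((splits L).map fun P =>
      (r * f P.1.length P.2.length) • φ (S.val P.1 * S.val P.2)).sum =
      (r * unshuffleSum S.ε f L.length) • φ (S.val L) := by
  simp only [mul_smul, ← map_smul φ]
  rw [← sum_splits_val, List.smul_sum, map_list_sum, List.map_map, List.map_map]
  rfl

lemma form_gc3B (hc : c.Supported) (L₁ L₂ L₃ L₄ : List (Hsp g)) :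
    S.form c (gc3B g (word L₁) (word L₂) (word L₃) (word L₄)) =
      c.unshuffleB S.ε L₁.length L₂.length L₃.length L₄.length • S.val₄ L₁ L₂ L₃ L₄ := by
  have key : ∀ P Q : List (Hsp g) × List (Hsp g),
      S.form c (Th g (barT g (word P.1)) (word (P.2 ++ L₂)) (barT g (word Q.1))
        (word (L₄ ++ Q.2))) =
      (antipodeSign S.ε P.1.length * (antipodeSign S.ε Q.1.length *
        S.ε ^ (L₄.length * Q.2.length) *
        c P.1.length (P.2.length + L₂.length) Q.1.length (L₄.length + Q.2.length))) •
        ((S.val P.1 * S.val P.2) * (S.val L₂ * ((S.val Q.1 * S.val Q.2) * S.val L₄))) := by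
    intro P Q
    rw [S.form_pure hc (S.isPure_barT_word _) (S.isPure_word _)
      (S.isPure_barT_word _) (S.isPure_word _)]
    simp only [val_append, List.length_append, smul_mul_assoc, mul_smul_comm, smul_smul, mul_assoc,
      S.val_mul_val L₄ Q.2]
    congr 1
    ring
  have inner : ∀ P : List (Hsp g) × List (Hsp g), _ := fun P =>
    S.sum_splits_map
      (LinearMap.mulLeft ℚ (S.val P.1 * S.val P.2) ∘ₗ LinearMap.mulLeft ℚ (S.val L₂) ∘ₗ
        LinearMap.mulRight ℚ (S.val L₄)) L₃ (antipodeSign S.ε P.1.length)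
      fun r' q' => antipodeSign S.ε r' * S.ε ^ (L₄.length * q') *
        c P.1.length (P.2.length + L₂.length) r' (L₄.length + q')
  have outer := S.sum_splits_map
    (LinearMap.mulRight ℚ (S.val L₂ * (S.val L₃ * S.val L₄))) L₁ 1
    fun r q => antipodeSign S.ε r * unshuffleSum S.ε (fun r' q' => antipodeSign S.ε r' *
      S.ε ^ (L₄.length * q') * c r (q + L₂.length) r' (L₄.length + q')) L₃.length
  simp only [LinearMap.comp_apply, LinearMap.mulLeft_apply, LinearMap.mulRight_apply] at inner
  simp only [LinearMap.mulRight_apply, one_mul] at outer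
  simp only [gc3B_word, map_list_sum, List.map_map, Function.comp_def, key, inner, outer]
  rfl

lemma form_gc3C (hc : c.Supported) (L₁ L₂ L₃ L₄ : List (Hsp g)) :
    S.form c (gc3C g (word L₁) (word L₂) (word L₃) (word L₄)) =
      c.unshuffleC S.ε L₁.length L₂.length L₃.length L₄.length • S.val₄ L₁ L₂ L₃ L₄ := by
  have key : ∀ P Q : List (Hsp g) × List (Hsp g),
      S.form c (Th g (word (L₁ ++ P.2)) (barT g (word P.1)) (word (Q.2 ++ L₃))
        (barT g (word Q.1))) =
      (antipodeSign S.ε P.1.length * S.ε ^ (P.2.length * P.1.length) *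
        (antipodeSign S.ε Q.1.length * S.ε ^ (Q.2.length * L₃.length + Q.2.length * Q.1.length) *
        c (L₁.length + P.2.length) P.1.length (Q.2.length + L₃.length) Q.1.length)) •
        (S.val L₁ * ((S.val P.1 * S.val P.2) * (S.val L₃ * (S.val Q.1 * S.val Q.2)))) := by
    intro P Q
    rw [S.form_pure hc (S.isPure_word _) (S.isPure_barT_word _) (S.isPure_word _)
      (S.isPure_barT_word _)]
    simp only [val_append, List.length_append, smul_mul_assoc, mul_smul_comm, smul_smul, mul_assoc,
      S.val_mul_val_mul P.2 P.1, S.val_mul_val_mul Q.2 L₃, S.val_mul_val Q.2 Q.1]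
    congr 1
    ring
  have inner : ∀ P : List (Hsp g) × List (Hsp g), _ := fun P =>
    S.sum_splits_map
      (LinearMap.mulLeft ℚ (S.val L₁) ∘ₗ LinearMap.mulLeft ℚ (S.val P.1 * S.val P.2) ∘ₗ
        LinearMap.mulLeft ℚ (S.val L₃)) L₄
      (antipodeSign S.ε P.1.length * S.ε ^ (P.2.length * P.1.length))
      fun r' q' => antipodeSign S.ε r' * S.ε ^ (q' * L₃.length + q' * r') *
        c (L₁.length + P.2.length) P.1.length (q' + L₃.length) r'
  have outer := S.sum_splits_map
    (LinearMap.mulLeft ℚ (S.val L₁) ∘ₗ LinearMap.mulRight ℚ (S.val L₃ * S.val L₄)) L₂ 1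
    fun r q => antipodeSign S.ε r * S.ε ^ (q * r) *
      unshuffleSum S.ε (fun r' q' => antipodeSign S.ε r' * S.ε ^ (q' * L₃.length + q' * r') *
        c (L₁.length + q) r (q' + L₃.length) r') L₄.length
  simp only [LinearMap.comp_apply, LinearMap.mulLeft_apply] at inner
  simp only [LinearMap.comp_apply, LinearMap.mulLeft_apply, LinearMap.mulRight_apply,
    one_mul] at outer
  simp only [gc3C_word, map_list_sum, List.map_map, Function.comp_def, key, inner, outer]
  rfl

lemma form_gc3 (hc : c.Supported) (L₁ L₂ L₃ L₄ : List (Hsp g)) :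
    S.form c (gc3 g (word L₁) (word L₂) (word L₃) (word L₄)) =
      (c L₁.length L₂.length L₃.length L₄.length +
        c.unshuffleB S.ε L₁.length L₂.length L₃.length L₄.length +
        c.unshuffleC S.ε L₁.length L₂.length L₃.length L₄.length) • S.val₄ L₁ L₂ L₃ L₄ := by
  rw [gc3, map_add, map_add, form_word S hc, form_gc3B S hc, form_gc3C S hc, add_smul, add_smul]

end SignedModel

/-! ### Equivariant multilinear maps -/

lemma mem_span_eigenvectors {V : Type*} [AddCommGroup V] [Module ℚ V] (f : Module.End ℚ V)
    {s : Set V} (hs : ∀ m ∈ s, ∃ μ : ℚ, f m = μ • m) {x : V} (hx : x ∈ Submodule.span ℚ s) {μ : ℚ}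
    (hμ : f x = μ • x) : x ∈ Submodule.span ℚ {m ∈ s | f m = μ • m} := by
  have hsplit : s = {m ∈ s | f m = μ • m} ∪ {m ∈ s | f m ≠ μ • m} := by
    ext m; simp only [Set.mem_union, Set.mem_ofPred_eq]; tauto
  rw [hsplit, Submodule.span_union, Submodule.mem_sup] at hx
  obtain ⟨y, hy, z, hz, rfl⟩ := hx
  have hy' : y ∈ f.eigenspace μ :=
    Submodule.span_le.2 (fun m hm => Module.End.mem_eigenspace_iff.2 hm.2) hy
  have hz₁ : z ∈ f.eigenspace μ := by
    rw [Module.End.mem_eigenspace_iff] at hy' ⊢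
    rw [map_add, smul_add, hy'] at hμ
    exact add_left_cancel hμ
  have hz₂ : z ∈ ⨆ ν, ⨆ (_ : ν ≠ μ), f.eigenspace ν := by
    refine Submodule.span_le.2 (fun m hm => ?_) hz
    obtain ⟨ν, hν⟩ := hs m hm.1
    have hne : ν ≠ μ := fun h => hm.2 (h ▸ hν)
    exact Submodule.mem_iSup_of_mem ν (Submodule.mem_iSup_of_mem hne
      (Module.End.mem_eigenspace_iff.2 hν))
  have hz₀ : z = 0 := (Submodule.disjoint_def.1 (f.eigenspaces_iSupIndep μ)) z hz₁ hz₂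
  rw [hz₀, add_zero]
  exact hy

lemma exists_linearEquiv_comp_eq {V ι : Type*} [AddCommGroup V] [Module ℚ V]
    [FiniteDimensional ℚ V] {v w : ι → V} (hv : LinearIndependent ℚ v)
    (hw : LinearIndependent ℚ w) : ∃ σ : V ≃ₗ[ℚ] V, ∀ i, σ (v i) = w i := by
  obtain ⟨σ, hσ⟩ := Submodule.exists_linearEquiv_restrict_eq
    (hv.linearCombinationEquiv.symm.trans hw.linearCombinationEquiv)
  refine ⟨σ, fun i => ?_⟩
  have h := hσ (hv.linearCombinationEquiv (Finsupp.single i 1))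
  simp only [LinearEquiv.trans_apply, LinearEquiv.symm_apply_apply] at h
  simpa only [LinearIndependent.linearCombinationEquiv_apply_coe, Finsupp.linearCombination_single,
    one_smul] using h.symm

lemma MultilinearMap.eq_zero_of_linearIndependent {V A : Type*} [AddCommGroup V] [Module ℚ V]
    [FiniteDimensional ℚ V] [AddCommGroup A] [Module ℚ A] {n : ℕ}
    (hn : n + n ≤ Module.finrank ℚ V) (K : MultilinearMap ℚ (fun _ : Fin n => V) A)
    (hK : ∀ v, LinearIndependent ℚ v → K v = 0) (v : Fin n → V) : K v = 0 := by
  set W := Submodule.span ℚ (Set.range v)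
  have hW : Module.finrank ℚ W ≤ n := by
    simpa [Set.finrank] using finrank_range_le_card (R := ℚ) v
  have hQ : n ≤ Module.finrank ℚ (V ⧸ W) := by
    have := W.finrank_quotient_add_finrank
    omega
  obtain ⟨q, hq⟩ := exists_linearIndependent_of_le_finrank hQ
  choose f hf using fun p => W.mkQ_surjective (q p)
  have hv : v = (v + f) + -f := by abel
  rw [hv, K.map_add_univ]
  refine Finset.sum_eq_zero fun s _ => hK _ (LinearIndependent.of_comp W.mkQ ?_)
  convert hq.units_smul (s.piecewise 1 (-1)) using 1
  ext p
  have hvp : W.mkQ (v p) = 0 :=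
    (Submodule.Quotient.mk_eq_zero W).2 (Submodule.subset_span ⟨p, rfl⟩)
  by_cases hp : p ∈ s
  · simp [Finset.piecewise_eq_of_mem _ _ _ hp, hvp, hf, -Submodule.mkQ_apply]
  · simp [Finset.piecewise_eq_of_notMem _ _ _ hp, hf, -Submodule.mkQ_apply]

/-- The linear automorphism of `H` scaling the coordinates by distinct primes. -/
def primeScaling (g : ℕ) : Hsp g ≃ₗ[ℚ] Hsp g :=
  LinearEquiv.piCongrRight fun i => LinearEquiv.smulOfNeZero ℚ ℚ (Nat.nth Nat.Prime i : ℚ)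
    (by exact_mod_cast (Nat.prime_nth_prime i).ne_zero)

lemma primeScaling_single (g : ℕ) (i : Fin (2 * g)) :
    primeScaling g (Pi.single i 1) = (Nat.nth Nat.Prime i : ℚ) • Pi.single i 1 := by
  ext j
  by_cases h : j = i
  · subst h; simp [primeScaling]
  · simp [primeScaling, h]

namespace SignedModel

variable {g : ℕ} {A : Type} [Ring A] [Algebra ℚ A] (S : SignedModel g A)

lemma act_val (σ : Hsp g ≃ₗ[ℚ] Hsp g) (L : List (Hsp g)) :
    S.act σ (S.val L) = S.val (L.map σ) := by
  induction L with
  | nil => simp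
  | cons a L ih => simp [ih, S.act_ℓ]

lemma exists_val_eq_smul_of_perm {L L' : List (Hsp g)} (h : L.Perm L') :
    ∃ r : ℚ, S.val L = r • S.val L' := by
  induction h with
  | nil => exact ⟨1, by simp⟩
  | cons a _ ih =>
    obtain ⟨r, hr⟩ := ih
    exact ⟨r, by rw [val_cons, hr, val_cons, mul_smul_comm]⟩
  | swap a b L =>
    refine ⟨S.ε, ?_⟩
    simp only [val_cons, ← mul_assoc]
    rw [S.comm, smul_mul_assoc]
  | trans _ _ ih ih' =>
    obtain ⟨r, hr⟩ := ih
    obtain ⟨r', hr'⟩ := ih'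
    exact ⟨r * r', by rw [hr, hr', smul_smul]⟩

lemma act_primeScaling_val (a : List (Fin (2 * g))) :
    S.act (primeScaling g) (S.val (a.map fun i => Pi.single i 1)) =
      (((a.map fun i : Fin (2 * g) => Nat.nth Nat.Prime i).prod : ℕ) : ℚ) •
        S.val (a.map fun i => Pi.single i 1) := by
  induction a with
  | nil => simp
  | cons i a ih =>
    simp only [List.map_cons, val_cons, map_mul, ih, S.act_ℓ, primeScaling_single, map_smul,
      smul_mul_assoc, mul_smul_comm, smul_smul, List.prod_cons, Nat.cast_mul,
      mul_comm (Nat.cast (List.prod _) : ℚ)]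

lemma perm_of_prod_nth_prime_eq {a b : List (Fin (2 * g))}
    (h : (a.map fun i : Fin (2 * g) => Nat.nth Nat.Prime i).prod =
      (b.map fun i : Fin (2 * g) => Nat.nth Nat.Prime i).prod) : a.Perm b := by
  have hinj : Function.Injective fun i : Fin (2 * g) => Nat.nth Nat.Prime (i : ℕ) :=
    (Nat.nth_injective Nat.infinite_setOfPred_prime).comp Fin.val_injective
  have hp : ∀ c : List (Fin (2 * g)),
      ∀ p ∈ c.map fun i : Fin (2 * g) => Nat.nth Nat.Prime i, p.Prime := by
    intro c p hp
    obtain ⟨i, -, rfl⟩ := List.mem_map.1 hp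
    exact Nat.prime_nth_prime i
  exact (List.map_perm_map_iff hinj).1 ((Nat.primeFactorsList_unique h (hp a)).trans
    (Nat.primeFactorsList_unique rfl (hp b)).symm)

/-- An equivariant multilinear map into the part of degree `n` of the model is a multiple of the
product. -/
theorem exists_eq_smul_val {n : ℕ} (hn : n ≤ g)
    (F : MultilinearMap ℚ (fun _ : Fin n => Hsp g) A)
    (hF : ∀ v, F v ∈ (LinearMap.range S.ℓ) ^ n)
    (hσ : ∀ (σ : Hsp g ≃ₗ[ℚ] Hsp g) v, F (fun p => σ (v p)) = S.act σ (F v)) :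
    ∃ r : ℚ, ∀ v, F v = r • S.val (List.ofFn v) := by
  let b : Fin n → Fin (2 * g) := fun p => ⟨p, by omega⟩
  let e : Fin n → Hsp g := fun p => Pi.single (b p) 1
  have he : LinearIndependent ℚ e := by
    have hb : Function.Injective b := fun p q h => Fin.ext (Fin.mk.inj h)
    simpa [e, Function.comp_def, Pi.basisFun_apply] using
      ((Pi.basisFun ℚ (Fin (2 * g))).linearIndependent).comp b hb
  have heig : S.act (primeScaling g) (F e) =
      ((((List.ofFn b).map fun i : Fin (2 * g) => Nat.nth Nat.Prime i).prod : ℕ) : ℚ) • F e := by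
    rw [← hσ]
    simp only [e, primeScaling_single]
    rw [F.map_smul_univ]
    simp [List.map_ofFn, List.prod_ofFn]
  have hspan : F e ∈ Submodule.span ℚ
      (Set.range fun a : List (Fin (2 * g)) => S.val (a.map fun i => Pi.single i 1)) := by
    refine Submodule.span_mono ?_ (pow_range_le_span S.ℓ _ (Pi.basisFun ℚ (Fin (2 * g))).span_eq n
      (hF e))
    rintro _ ⟨v, hv, rfl⟩
    choose a ha using hv
    refine ⟨List.ofFn a, ?_⟩
    simp only [val, List.map_ofFn, Function.comp_def, ← ha, Pi.basisFun_apply]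
  have hmem := mem_span_eigenvectors (S.act (primeScaling g)).toLinearMap
    (by rintro _ ⟨a, rfl⟩; exact ⟨_, S.act_primeScaling_val a⟩) hspan heig
  have hle : F e ∈ Submodule.span ℚ {S.val (List.ofFn e)} := by
    refine Submodule.span_le.2 ?_ hmem
    rintro _ ⟨⟨a, rfl⟩, ha⟩
    by_cases h0 : S.val (a.map fun i => Pi.single i 1) = 0
    · simp [h0]
    have hprod := smul_left_injective ℚ h0 ((S.act_primeScaling_val a).symm.trans ha)
    obtain ⟨r, hr⟩ := S.exists_val_eq_smul_of_perm
      ((perm_of_prod_nth_prime_eq (Nat.cast_injective hprod)).map fun i => Pi.single i 1)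
    refine Submodule.mem_span_singleton.2 ⟨r, ?_⟩
    rw [List.map_ofFn] at hr
    exact hr.symm
  obtain ⟨r, hr⟩ := Submodule.mem_span_singleton.1 hle
  let P : MultilinearMap ℚ (fun _ : Fin n => Hsp g) A :=
    (MultilinearMap.mkPiAlgebraFin ℚ n A).compLinearMap fun _ => S.ℓ
  have hP : ∀ v, P v = S.val (List.ofFn v) := fun v => by
    simp [P, val, List.map_ofFn, Function.comp_def]
  have hK : ∀ v, (F - r • P) v = 0 := by
    refine MultilinearMap.eq_zero_of_linearIndependent (by simp; omega) _ fun v hv => ?_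
    obtain ⟨σ, hσv⟩ := exists_linearEquiv_comp_eq he hv
    obtain rfl : v = fun p => σ (e p) := funext fun p => (hσv p).symm
    have hvσ : S.val (List.ofFn fun p => σ (e p)) = S.act σ (S.val (List.ofFn e)) := by
      rw [act_val, List.map_ofFn]
      rfl
    simp only [sub_apply, smul_apply, hP, hσ, hvσ, ← hr, map_smul,
      sub_self]
  refine ⟨r, fun v => ?_⟩
  have h := hK v
  simp only [sub_apply, smul_apply, hP] at h
  exact sub_eq_zero.1 h

end SignedModel

/-! ### Equivariant forms on `T⊗T⊗T⊗T` -/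

lemma T4map_Th (g : ℕ) (φ : Hsp g →ₗ[ℚ] Hsp g) (t u v w : TA g) :
    T4map g φ (Th g t u v w) =
      Th g (TAmap g φ t) (TAmap g φ u) (TAmap g φ v) (TAmap g φ w) := rfl

lemma TAmap_word (g : ℕ) (φ : Hsp g →ₗ[ℚ] Hsp g) (L : List (Hsp g)) :
    TAmap g φ (word L) = word (L.map φ) := by
  induction L with
  | nil => simp
  | cons a L ih => rw [word_cons, map_mul, ih]; simp [TAmap]

lemma Th_word_mem_T4deg {g m : ℕ} {L₁ L₂ L₃ L₄ : List (Hsp g)}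
    (h : L₁.length + L₂.length + L₃.length + L₄.length = m) :
    Th g (word L₁) (word L₂) (word L₃) (word L₄) ∈ T4deg g m :=
  Submodule.subset_span ⟨_, _, _, _, h, _, word_mem_TAdeg _, _, word_mem_TAdeg _, _,
    word_mem_TAdeg _, _, word_mem_TAdeg _, rfl⟩

/-- To prove that a linear map vanishes on `T⊗T⊗T⊗T` in degree `m`, it suffices to
consider words. -/
lemma eq_zero_of_mem_T4deg {g m : ℕ} {V : Type*} [AddCommGroup V] [Module ℚ V]
    {φ : T4 g →ₗ[ℚ] V}
    (h : ∀ L₁ L₂ L₃ L₄ : List (Hsp g), L₁.length + L₂.length + L₃.length + L₄.length = m →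
      φ (Th g (word L₁) (word L₂) (word L₃) (word L₄)) = 0) {x : T4 g} (hx : x ∈ T4deg g m) :
    φ x = 0 := by
  refine LinearMap.eqOn_span (f := φ) (g := 0) ?_ hx
  rintro _ ⟨i, j, k, l, hm, t, ht, u, hu, v, hv, w, hw, rfl⟩
  refine (isLinear₄_map_Th φ).eq_zero_of_mem_span ?_ (TAdeg_le_span_word _ _ ht)
    (TAdeg_le_span_word _ _ hu) (TAdeg_le_span_word _ _ hv) (TAdeg_le_span_word _ _ hw)
  rintro _ ⟨L₁, rfl, rfl⟩ _ ⟨L₂, rfl, rfl⟩ _ ⟨L₃, rfl, rfl⟩ _ ⟨L₄, rfl, rfl⟩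
  exact h L₁ L₂ L₃ L₄ hm

/-- The inclusion of the generators in one of the slots of `T⊗T⊗T⊗T`. -/
def slot (g : ℕ) : Fin 4 → Hsp g →ₗ[ℚ] T4 g :=
  ![(TensorProduct.mk ℚ _ _).flip 1 ∘ₗ TensorAlgebra.ι ℚ,
    TensorProduct.mk ℚ _ _ 1 ∘ₗ (TensorProduct.mk ℚ _ _).flip 1 ∘ₗ TensorAlgebra.ι ℚ,
    TensorProduct.mk ℚ _ _ 1 ∘ₗ TensorProduct.mk ℚ _ _ 1 ∘ₗ (TensorProduct.mk ℚ _ _).flip 1 ∘ₗ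
      TensorAlgebra.ι ℚ,
    TensorProduct.mk ℚ _ _ 1 ∘ₗ TensorProduct.mk ℚ _ _ 1 ∘ₗ TensorProduct.mk ℚ _ _ 1 ∘ₗ
      TensorAlgebra.ι ℚ]

lemma Th_mul (g : ℕ) (t u v w t' u' v' w' : TA g) :
    Th g t u v w * Th g t' u' v' w' = Th g (t * t') (u * u') (v * v') (w * w') := by
  simp [Th]

lemma prod_slot_zero {g : ℕ} (L : List (Hsp g)) :
    (L.map (slot g 0)).prod = Th g (word L) 1 1 1 := by
  induction L with
  | nil => rfl
  | cons a L ih =>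
    have h : slot g 0 a = Th g (TensorAlgebra.ι ℚ a) 1 1 1 := rfl
    simp [ih, h, Th_mul]

lemma prod_slot_one {g : ℕ} (L : List (Hsp g)) :
    (L.map (slot g 1)).prod = Th g 1 (word L) 1 1 := by
  induction L with
  | nil => rfl
  | cons a L ih =>
    have h : slot g 1 a = Th g 1 (TensorAlgebra.ι ℚ a) 1 1 := rfl
    simp [ih, h, Th_mul]

lemma prod_slot_two {g : ℕ} (L : List (Hsp g)) :
    (L.map (slot g 2)).prod = Th g 1 1 (word L) 1 := by
  induction L with
  | nil => rfl
  | cons a L ih =>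
    have h : slot g 2 a = Th g 1 1 (TensorAlgebra.ι ℚ a) 1 := rfl
    simp [ih, h, Th_mul]

lemma prod_slot_three {g : ℕ} (L : List (Hsp g)) :
    (L.map (slot g 3)).prod = Th g 1 1 1 (word L) := by
  induction L with
  | nil => rfl
  | cons a L ih =>
    have h : slot g 3 a = Th g 1 1 1 (TensorAlgebra.ι ℚ a) := rfl
    simp [ih, h, Th_mul]

lemma zipWith_replicate_length {α β γ : Type*} (f : α → β → γ) (a : α) (L : List β) :
    List.zipWith f (List.replicate L.length a) L = L.map (f a) := by
  induction L with
  | nil => rfl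
  | cons b L ih => simp [List.replicate_succ, ih]

/-- The slots of the letters in a product of words of given lengths. -/
def slotPattern (i j k l : ℕ) : List (Fin 4) :=
  List.replicate i 0 ++ (List.replicate j 1 ++ (List.replicate k 2 ++ List.replicate l 3))

lemma prod_zipWith_slotPattern {g : ℕ} (L₁ L₂ L₃ L₄ : List (Hsp g)) :
    (List.zipWith (fun s => slot g s) (slotPattern L₁.length L₂.length L₃.length L₄.length)
      (L₁ ++ (L₂ ++ (L₃ ++ L₄)))).prod = Th g (word L₁) (word L₂) (word L₃) (word L₄) := by
  rw [slotPattern, List.zipWith_append (by simp), List.zipWith_append (by simp),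
    List.zipWith_append (by simp)]
  simp only [zipWith_replicate_length, List.prod_append, prod_slot_zero, prod_slot_one,
    prod_slot_two, prod_slot_three, Th_mul, one_mul, mul_one]

lemma exists_append_eq {α : Type*} (L : List α) {i j k l : ℕ} (h : L.length = i + j + k + l) :
    ∃ L₁ L₂ L₃ L₄, L₁.length = i ∧ L₂.length = j ∧ L₃.length = k ∧ L₄.length = l ∧
      L = L₁ ++ (L₂ ++ (L₃ ++ L₄)) := by
  refine ⟨L.take i, (L.drop i).take j, ((L.drop i).drop j).take k, ((L.drop i).drop j).drop k,
    ?_, ?_, ?_, ?_, by simp⟩ <;> simp only [List.length_take, List.length_drop] <;> omega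

namespace SignedModel

variable {g : ℕ} {A : Type} [Ring A] [Algebra ℚ A] (S : SignedModel g A)

lemma exists_coef_word (hg : 4 ≤ g) {Ψ : T4 g →ₗ[ℚ] A}
    (hΨ : ∀ x ∈ T4deg g 4, Ψ x ∈ (LinearMap.range S.ℓ) ^ 4)
    (hσ : ∀ (σ : Hsp g ≃ₗ[ℚ] Hsp g), ∀ x ∈ T4deg g 4,
      Ψ (T4map g σ.toLinearMap x) = S.act σ (Ψ x))
    {i j k l : ℕ} (h : i + j + k + l = 4) :
    ∃ r : ℚ, ∀ L₁ L₂ L₃ L₄ : List (Hsp g), L₁.length = i → L₂.length = j → L₃.length = k →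
      L₄.length = l → Ψ (Th g (word L₁) (word L₂) (word L₃) (word L₄)) = r • S.val₄ L₁ L₂ L₃ L₄ := by
  have hlen : (slotPattern i j k l).length = 4 := by simp [slotPattern]; omega
  let F : MultilinearMap ℚ (fun _ : Fin 4 => Hsp g) A :=
    Ψ.compMultilinearMap ((MultilinearMap.mkPiAlgebraFin ℚ 4 (T4 g)).compLinearMap
      fun p => slot g ((slotPattern i j k l)[p]))
  have hF : ∀ (v : Fin 4 → Hsp g) (L₁ L₂ L₃ L₄ : List (Hsp g)), L₁.length = i → L₂.length = j →
      L₃.length = k → L₄.length = l → List.ofFn v = L₁ ++ (L₂ ++ (L₃ ++ L₄)) →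
      F v = Ψ (Th g (word L₁) (word L₂) (word L₃) (word L₄)) := by
    rintro v L₁ L₂ L₃ L₄ rfl rfl rfl rfl hv
    rw [← prod_zipWith_slotPattern, ← hv]
    simp only [F, LinearMap.compMultilinearMap_apply, MultilinearMap.compLinearMap_apply,
      MultilinearMap.mkPiAlgebraFin_apply]
    congr 2
    refine List.ext_getElem (by simp [hlen]) fun p h₁ h₂ => ?_
    simp only [List.getElem_ofFn, List.getElem_zipWith]
    rfl
  have hsplit : ∀ v : Fin 4 → Hsp g, ∃ L₁ L₂ L₃ L₄ : List (Hsp g), L₁.length = i ∧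
      L₂.length = j ∧ L₃.length = k ∧ L₄.length = l ∧ List.ofFn v = L₁ ++ (L₂ ++ (L₃ ++ L₄)) :=
    fun v => exists_append_eq _ (by simp [h])
  obtain ⟨r, hr⟩ := S.exists_eq_smul_val hg F
    (fun v => by
      obtain ⟨L₁, L₂, L₃, L₄, h₁, h₂, h₃, h₄, hv⟩ := hsplit v
      rw [hF v L₁ L₂ L₃ L₄ h₁ h₂ h₃ h₄ hv]
      exact hΨ _ (Th_word_mem_T4deg (by omega)))
    (fun σ v => by
      obtain ⟨L₁, L₂, L₃, L₄, h₁, h₂, h₃, h₄, hv⟩ := hsplit v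
      rw [hF v L₁ L₂ L₃ L₄ h₁ h₂ h₃ h₄ hv, ← hσ _ _ (Th_word_mem_T4deg (by omega)), T4map_Th]
      simp only [TAmap_word]
      refine hF _ _ _ _ _ (by simpa) (by simpa) (by simpa) (by simpa) ?_
      have := congrArg (List.map σ) hv
      simpa [List.map_ofFn, Function.comp_def] using this)
  refine ⟨r, fun L₁ L₂ L₃ L₄ h₁ h₂ h₃ h₄ => ?_⟩
  have hL : (L₁ ++ (L₂ ++ (L₃ ++ L₄))).length = 4 := by simp; omega
  have hv : List.ofFn (fun p : Fin 4 => (L₁ ++ (L₂ ++ (L₃ ++ L₄)))[p]) =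
      L₁ ++ (L₂ ++ (L₃ ++ L₄)) :=
    List.ext_getElem (by rw [List.length_ofFn, hL]) fun p _ _ => by
      simp only [List.getElem_ofFn, Fin.getElem_fin]
  rw [← hF _ L₁ L₂ L₃ L₄ h₁ h₂ h₃ h₄ hv, hr, hv, val₄, val_append, val_append, val_append]

/-- Every equivariant map of degree four is given by coefficients. -/
theorem exists_form_eq (hg : 4 ≤ g) {Ψ : T4 g →ₗ[ℚ] A}
    (hΨ : ∀ x ∈ T4deg g 4, Ψ x ∈ (LinearMap.range S.ℓ) ^ 4)
    (hσ : ∀ (σ : Hsp g ≃ₗ[ℚ] Hsp g), ∀ x ∈ T4deg g 4,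
      Ψ (T4map g σ.toLinearMap x) = S.act σ (Ψ x)) :
    ∃ c : Coef, c.Supported ∧ ∀ x ∈ T4deg g 4, Ψ x = S.form c x := by
  have hex : ∀ i j k l : ℕ, ∃ r : ℚ, (i + j + k + l ≠ 4 → r = 0) ∧
      (i + j + k + l = 4 → ∀ L₁ L₂ L₃ L₄ : List (Hsp g), L₁.length = i → L₂.length = j →
        L₃.length = k → L₄.length = l →
        Ψ (Th g (word L₁) (word L₂) (word L₃) (word L₄)) = r • S.val₄ L₁ L₂ L₃ L₄) := by
    intro i j k l
    by_cases h : i + j + k + l = 4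
    · obtain ⟨r, hr⟩ := S.exists_coef_word hg hΨ hσ h
      exact ⟨r, fun h' => absurd h h', fun _ => hr⟩
    · exact ⟨0, fun _ => rfl, fun h' => absurd h' h⟩
  choose c hc hcw using hex
  refine ⟨c, hc, fun x hx => sub_eq_zero.1 ?_⟩
  refine eq_zero_of_mem_T4deg (φ := Ψ - S.form c) (fun L₁ L₂ L₃ L₄ h => ?_) hx
  rw [LinearMap.sub_apply, S.form_word hc, hcw _ _ _ _ h _ _ _ _ rfl rfl rfl rfl, sub_self]

lemma val_mem (L : List (Hsp g)) : S.val L ∈ (LinearMap.range S.ℓ) ^ L.length := by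
  induction L with
  | nil => exact Submodule.one_le.1 (pow_zero (LinearMap.range S.ℓ)).ge
  | cons a L ih =>
    rw [val_cons, List.length_cons, pow_succ']
    exact Submodule.mul_mem_mul ⟨a, rfl⟩ ih

lemma form_mem {c : Coef} (hc : c.Supported) {x : T4 g} (hx : x ∈ T4deg g 4) :
    S.form c x ∈ (LinearMap.range S.ℓ) ^ 4 := by
  rw [← Submodule.Quotient.mk_eq_zero]
  refine eq_zero_of_mem_T4deg (φ := Submodule.mkQ _ ∘ₗ S.form c) (fun L₁ L₂ L₃ L₄ h => ?_) hx
  refine (Submodule.Quotient.mk_eq_zero _).2 ?_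
  rw [S.form_word hc]
  have := S.val_mem (L₁ ++ (L₂ ++ (L₃ ++ L₄)))
  simp only [List.length_append, ← add_assoc, h, val_append] at this
  exact Submodule.smul_mem _ _ this

lemma form_T4map {c : Coef} (hc : c.Supported) (σ : Hsp g ≃ₗ[ℚ] Hsp g) (x : T4 g) :
    S.form c (T4map g σ.toLinearMap x) = S.act σ (S.form c x) := by
  have hx : x ∈ Submodule.span ℚ {x | ∃ t u v w, Th g t u v w = x} := by
    induction x using TensorProduct.induction_on with
    | zero => exact Submodule.zero_mem _
    | add x y hx hy => exact Submodule.add_mem _ hx hy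
    | tmul t y =>
      induction y using TensorProduct.induction_on with
      | zero => simp
      | add x y hx hy => rw [TensorProduct.tmul_add]; exact Submodule.add_mem _ hx hy
      | tmul u y =>
        induction y using TensorProduct.induction_on with
        | zero => simp
        | add x y hx hy =>
          rw [TensorProduct.tmul_add, TensorProduct.tmul_add]; exact Submodule.add_mem _ hx hy
        | tmul v w => exact Submodule.subset_span ⟨t, u, v, w, rfl⟩
  refine LinearMap.eqOn_span (f := S.form c ∘ₗ T4map g σ.toLinearMap)
    (g := (S.act σ).toLinearMap ∘ₗ S.form c) ?_ hx
  rintro _ ⟨t, u, v, w, rfl⟩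
  refine sub_eq_zero.1 ((isLinear₄_map_Th (S.form c ∘ₗ T4map g σ.toLinearMap -
    (S.act σ).toLinearMap ∘ₗ S.form c)).eq_zero_of_word (fun L₁ L₂ L₃ L₄ => ?_) t u v w)
  simp only [LinearMap.sub_apply, LinearMap.comp_apply, T4map_Th, TAmap_word, S.form_word hc,
    AlgHom.toLinearMap_apply, map_smul, val₄, map_mul, act_val, List.length_map,
    LinearEquiv.coe_toLinearMap, sub_self]

end SignedModel

/-! ### Vanishing of forms on the relations -/

section Linearity

variable {g : ℕ} {V : Type*} [AddCommGroup V] [Module ℚ V]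

lemma IsLinear₄.add {f f' : TA g → TA g → TA g → TA g → V} (h : IsLinear₄ f) (h' : IsLinear₄ f') :
    IsLinear₄ fun t u v w => f t u v w + f' t u v w where
  fst u v w := ((h.fst u v w).mk' _ + (h'.fst u v w).mk' _).isLinear
  snd t v w := ((h.snd t v w).mk' _ + (h'.snd t v w).mk' _).isLinear
  trd t u w := ((h.trd t u w).mk' _ + (h'.trd t u w).mk' _).isLinear
  fth t u v := ((h.fth t u v).mk' _ + (h'.fth t u v).mk' _).isLinear

lemma IsLinear₄.sub {f f' : TA g → TA g → TA g → TA g → V} (h : IsLinear₄ f) (h' : IsLinear₄ f') :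
    IsLinear₄ fun t u v w => f t u v w - f' t u v w where
  fst u v w := ((h.fst u v w).mk' _ - (h'.fst u v w).mk' _).isLinear
  snd t v w := ((h.snd t v w).mk' _ - (h'.snd t v w).mk' _).isLinear
  trd t u w := ((h.trd t u w).mk' _ - (h'.trd t u w).mk' _).isLinear
  fth t u v := ((h.fth t u v).mk' _ - (h'.fth t u v).mk' _).isLinear

/-- Substitution of linear maps in the arguments. -/
lemma IsLinear₄.comp {f : TA g → TA g → TA g → TA g → V} (h : IsLinear₄ f)
    (α β γ δ : TA g →ₗ[ℚ] TA g) : IsLinear₄ fun t u v w => f (α t) (β u) (γ v) (δ w) where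
  fst u v w := ((h.fst (β u) (γ v) (δ w)).mk' _ ∘ₗ α).isLinear
  snd t v w := ((h.snd (α t) (γ v) (δ w)).mk' _ ∘ₗ β).isLinear
  trd t u w := ((h.trd (α t) (β u) (δ w)).mk' _ ∘ₗ γ).isLinear
  fth t u v := ((h.fth (α t) (β u) (γ v)).mk' _ ∘ₗ δ).isLinear

lemma isLinear₄_thetaFlip (φ : T4 g →ₗ[ℚ] V) : IsLinear₄ fun t u v w =>
    φ (Th g t u v w - Th g (barT g v) (barT g w) (barT g t) (barT g u)) := by
  have h := (isLinear₄_map_Th φ).comp (barT g) (barT g) (barT g) (barT g)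
  simp only [map_sub]
  exact (isLinear₄_map_Th φ).sub ⟨fun u v w => h.trd v w u, fun t v w => h.fth v w t,
    fun t u w => h.fst w t u, fun t u v => h.snd v t u⟩

lemma isLinear₄_swap (φ : T4 g →ₗ[ℚ] V) : IsLinear₄ fun t u v w =>
    φ (Th g t u v w - Th g (barT g u) (barT g t) (barT g w) (barT g v)) := by
  have h := (isLinear₄_map_Th φ).comp (barT g) (barT g) (barT g) (barT g)
  simp only [map_sub]
  exact (isLinear₄_map_Th φ).sub ⟨fun u v w => h.snd u w v, fun t v w => h.fst t w v,
    fun t u w => h.fth u t w, fun t u v => h.trd u t v⟩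

lemma isLinear₄_cross (φ : T4 g →ₗ[ℚ] V) : IsLinear₄ fun t u v w =>
    φ (Th g (barT g v) u (barT g t) w) := by
  have h := (isLinear₄_map_Th φ).comp (barT g) LinearMap.id (barT g) LinearMap.id
  exact ⟨fun u v w => h.trd v u w, fun t v w => h.snd v t w,
    fun t u w => h.fst u t w, fun t u v => h.fth v u t⟩

lemma isLinear₄_balance (φ : T4 g →ₗ[ℚ] V) (a : Hsp g) : IsLinear₄ fun t u v w =>
    φ (Th g t u v (w * TensorAlgebra.ι ℚ a) - Th g t u (TensorAlgebra.ι ℚ a * v) w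
      - Th g t (TensorAlgebra.ι ℚ a * u) v w + Th g (t * TensorAlgebra.ι ℚ a) u v w) := by
  have h := isLinear₄_map_Th φ
  let l := LinearMap.mulLeft ℚ (TensorAlgebra.ι ℚ a)
  let r := LinearMap.mulRight ℚ (TensorAlgebra.ι ℚ a)
  let i : TA g →ₗ[ℚ] TA g := LinearMap.id
  simp only [map_sub, map_add]
  exact (((h.comp i i i r).sub (h.comp i i l i)).sub (h.comp i l i i)).add (h.comp r i i i)

lemma isLinear₄_gc3B (φ : T4 g →ₗ[ℚ] V) : IsLinear₄ fun t u v w => φ (gc3B g t u v w) := by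
  have hr : ∀ u : TA g, LinearMap.mulRight ℚ u = (LinearMap.mul ℚ (TA g)).flip u := fun _ => rfl
  have hl : ∀ u : TA g, LinearMap.mulLeft ℚ u = LinearMap.mul ℚ (TA g) u := fun _ => rfl
  constructor <;> intros <;> constructor <;> intros <;>
    simp only [gc3B, hr, hl, map_add, map_smul, TensorProduct.tmul_add, TensorProduct.add_tmul,
      TensorProduct.tmul_smul, ← TensorProduct.smul_tmul', TensorProduct.map_add_right,
      TensorProduct.map_smul_right, LinearMap.add_apply, LinearMap.smul_apply]

lemma isLinear₄_gc3C (φ : T4 g →ₗ[ℚ] V) : IsLinear₄ fun t u v w => φ (gc3C g t u v w) := by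
  have hr : ∀ u : TA g, LinearMap.mulRight ℚ u = (LinearMap.mul ℚ (TA g)).flip u := fun _ => rfl
  have hl : ∀ u : TA g, LinearMap.mulLeft ℚ u = LinearMap.mul ℚ (TA g) u := fun _ => rfl
  constructor <;> intros <;> constructor <;> intros <;>
    simp only [gc3C, hr, hl, map_add, map_smul, TensorProduct.tmul_add, TensorProduct.add_tmul,
      TensorProduct.tmul_smul, ← TensorProduct.smul_tmul', TensorProduct.map_add_right,
      TensorProduct.map_smul_right, LinearMap.add_apply, LinearMap.smul_apply]

lemma isLinear₄_gc3 (φ : T4 g →ₗ[ℚ] V) : IsLinear₄ fun t u v w => φ (gc3 g t u v w) := by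
  simp only [gc3, map_add]
  exact ((isLinear₄_map_Th φ).add (isLinear₄_gc3B φ)).add (isLinear₄_gc3C φ)

end Linearity

/-- Coefficients of a form on `T⊗T⊗T⊗T` which satisfies the relations of `Ω̃₂`. -/
structure Coef.IsOmega (ε : ℚ) (c : Coef) : Prop where
  supported : c.Supported
  thetaFlip : ∀ i j k l, i + j + k + l = 4 → c.thetaFlip ε i j k l = 0
  swap : ∀ i j k l, i + j + k + l = 4 → c.swap ε i j k l = 0
  balance : ∀ i j k l, i + j + k + l = 3 → c.balance ε i j k l = 0
  gc3 : ∀ i j k l, i + j + k + l = 4 →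
    c i j k l + c.unshuffleB ε i j k l + c.unshuffleC ε i j k l = 0

/-- Coefficients of a pair of forms on `T⊗T⊗T⊗T` which satisfies the relations of `C₁₂`. -/
structure Coef.IsC12 (ε : ℚ) (c d : Coef) : Prop where
  supported : c.Supported
  supported' : d.Supported
  thetaFlip : ∀ i j k l, i + j + k + l = 4 → c.thetaFlip ε i j k l = 0
  swap : ∀ i j k l, i + j + k + l = 4 → c.swap ε i j k l = 0
  cross : ∀ i j k l, i + j + k + l = 4 → d i j k l - d.cross ε i j k l = 0
  swap' : ∀ i j k l, i + j + k + l = 4 → d.swap ε i j k l = 0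
  balance : ∀ i j k l, i + j + k + l = 3 → c.balance ε i j k l = 0
  balance' : ∀ i j k l, i + j + k + l = 3 → d.balance ε i j k l = 0
  resolve : ∀ i j k l, i + j + k + l = 4 → d i j k l - c i j k l - c.cross ε i j k l = 0

section Supported

variable {c : Coef} (ε : ℚ) {i j k l : ℕ}

lemma Coef.Supported.thetaFlip (hc : c.Supported) (h : i + j + k + l ≠ 4) :
    c.thetaFlip ε i j k l = 0 := by
  rw [Coef.thetaFlip, hc i j k l h, hc k l i j (by omega)]
  ring

lemma Coef.Supported.swap (hc : c.Supported) (h : i + j + k + l ≠ 4) :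
    c.swap ε i j k l = 0 := by
  rw [Coef.swap, hc i j k l h, hc j i l k (by omega)]
  ring

lemma Coef.Supported.cross (hc : c.Supported) (h : i + j + k + l ≠ 4) :
    c.cross ε i j k l = 0 := by
  rw [Coef.cross, hc k j i l (by omega)]
  ring

lemma Coef.Supported.balance (hc : c.Supported) (h : i + j + k + l ≠ 3) :
    c.balance ε i j k l = 0 := by
  rw [Coef.balance, hc i j k (l + 1) (by omega), hc i j (k + 1) l (by omega),
    hc i (j + 1) k l (by omega), hc (i + 1) j k l (by omega)]
  ring

lemma Coef.Supported.unshuffleB (hc : c.Supported) (h : i + j + k + l ≠ 4) :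
    c.unshuffleB ε i j k l = 0 := by
  refine unshuffleSum_eq_zero _ _ _ fun r q hi => mul_eq_zero_of_right _ ?_
  refine unshuffleSum_eq_zero _ _ _ fun r' q' hk => mul_eq_zero_of_right _ ?_
  exact hc _ _ _ _ (by omega)

lemma Coef.Supported.unshuffleC (hc : c.Supported) (h : i + j + k + l ≠ 4) :
    c.unshuffleC ε i j k l = 0 := by
  refine unshuffleSum_eq_zero _ _ _ fun r q hi => mul_eq_zero_of_right _ ?_
  refine unshuffleSum_eq_zero _ _ _ fun r' q' hk => mul_eq_zero_of_right _ ?_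
  exact hc _ _ _ _ (by omega)

end Supported

lemma mem_OmegaRel {g : ℕ} {x : T4 g} : x ∈ OmegaRel g ↔
    (∃ t u v w : TA g, x = Th g t u v w - Th g (barT g v) (barT g w) (barT g t) (barT g u)) ∨
    (∃ t u v w : TA g, x = Th g t u v w - Th g (barT g u) (barT g t) (barT g w) (barT g v)) ∨
    (∃ (t u v w : TA g) (a : Hsp g), x = Th g t u v (w * TensorAlgebra.ι ℚ a)
      - Th g t u (TensorAlgebra.ι ℚ a * v) w - Th g t (TensorAlgebra.ι ℚ a * u) v w
      + Th g (t * TensorAlgebra.ι ℚ a) u v w) ∨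
    (∃ t u v w : TA g, x = gc3 g t u v w) :=
  Iff.rfl

lemma mem_C12Rel {g : ℕ} {x : P2 g} : x ∈ C12Rel g ↔
    (∃ t u v w : TA g,
      x = ThP g t u v w - ThP g (barT g v) (barT g w) (barT g t) (barT g u)) ∨
    (∃ t u v w : TA g,
      x = ThP g t u v w - ThP g (barT g u) (barT g t) (barT g w) (barT g v)) ∨
    (∃ t u v w : TA g, x = DP g t u v w - DP g (barT g v) u (barT g t) w) ∨
    (∃ t u v w : TA g,
      x = DP g t u v w - DP g (barT g u) (barT g t) (barT g w) (barT g v)) ∨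
    (∃ (t u v w : TA g) (a : Hsp g), x = ThP g t u v (w * TensorAlgebra.ι ℚ a)
      - ThP g t u (TensorAlgebra.ι ℚ a * v) w - ThP g t (TensorAlgebra.ι ℚ a * u) v w
      + ThP g (t * TensorAlgebra.ι ℚ a) u v w) ∨
    (∃ (t u v w : TA g) (a : Hsp g), x = DP g t u (TensorAlgebra.ι ℚ a * v) w
      - DP g (t * TensorAlgebra.ι ℚ a) u v w - DP g t u v (w * TensorAlgebra.ι ℚ a)
      + DP g t (TensorAlgebra.ι ℚ a * u) v w) ∨
    (∃ t u v w : TA g,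
      x = DP g t u v w - ThP g t u v w - ThP g (barT g v) u (barT g t) w) :=
  Iff.rfl

namespace SignedModel

variable {g : ℕ} {A : Type} [Ring A] [Algebra ℚ A] (S : SignedModel g A) {c d : Coef}

lemma form_thetaFlip_eq_zero (hc : c.Supported)
    (h : ∀ i j k l, i + j + k + l = 4 → c.thetaFlip S.ε i j k l = 0) (t u v w : TA g) :
    S.form c (Th g t u v w - Th g (barT g v) (barT g w) (barT g t) (barT g u)) = 0 := by
  refine (isLinear₄_thetaFlip (S.form c)).eq_zero_of_word (fun L₁ L₂ L₃ L₄ => ?_) t u v w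
  rw [S.form_thetaFlip hc]
  by_cases hl : L₁.length + L₂.length + L₃.length + L₄.length = 4
  · rw [h _ _ _ _ hl, zero_smul]
  · rw [hc.thetaFlip _ hl, zero_smul]

lemma form_swap_eq_zero (hc : c.Supported)
    (h : ∀ i j k l, i + j + k + l = 4 → c.swap S.ε i j k l = 0) (t u v w : TA g) :
    S.form c (Th g t u v w - Th g (barT g u) (barT g t) (barT g w) (barT g v)) = 0 := by
  refine (isLinear₄_swap (S.form c)).eq_zero_of_word (fun L₁ L₂ L₃ L₄ => ?_) t u v w
  rw [S.form_swap hc]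
  by_cases hl : L₁.length + L₂.length + L₃.length + L₄.length = 4
  · rw [h _ _ _ _ hl, zero_smul]
  · rw [hc.swap _ hl, zero_smul]

lemma form_balance_eq_zero (hc : c.Supported)
    (h : ∀ i j k l, i + j + k + l = 3 → c.balance S.ε i j k l = 0) (t u v w : TA g) (a : Hsp g) :
    S.form c (Th g t u v (w * TensorAlgebra.ι ℚ a)
        - Th g t u (TensorAlgebra.ι ℚ a * v) w - Th g t (TensorAlgebra.ι ℚ a * u) v w
        + Th g (t * TensorAlgebra.ι ℚ a) u v w) = 0 := by
  refine (isLinear₄_balance (S.form c) a).eq_zero_of_word (fun L₁ L₂ L₃ L₄ => ?_) t u v w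
  rw [S.form_balance hc]
  by_cases hl : L₁.length + L₂.length + L₃.length + L₄.length = 3
  · rw [h _ _ _ _ hl, zero_smul]
  · rw [hc.balance _ hl, zero_smul]

lemma form_gc3_eq_zero (hc : c.Supported)
    (h : ∀ i j k l, i + j + k + l = 4 →
      c i j k l + c.unshuffleB S.ε i j k l + c.unshuffleC S.ε i j k l = 0) (t u v w : TA g) :
    S.form c (gc3 g t u v w) = 0 := by
  refine (isLinear₄_gc3 (S.form c)).eq_zero_of_word (fun L₁ L₂ L₃ L₄ => ?_) t u v w
  rw [S.form_gc3 hc]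
  by_cases hl : L₁.length + L₂.length + L₃.length + L₄.length = 4
  · rw [h _ _ _ _ hl, zero_smul]
  · rw [hc _ _ _ _ hl, hc.unshuffleB _ hl, hc.unshuffleC _ hl, add_zero, add_zero, zero_smul]

lemma form_OmegaRel (h : c.IsOmega S.ε) {x : T4 g} (hx : x ∈ OmegaRel g) : S.form c x = 0 := by
  have hc := h.supported
  rcases mem_OmegaRel.1 hx with ⟨t, u, v, w, rfl⟩ | ⟨t, u, v, w, rfl⟩ | ⟨t, u, v, w, a, rfl⟩ |
    ⟨t, u, v, w, rfl⟩
  · have := S.form_thetaFlip_eq_zero hc h.thetaFlip t u v w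
    rwa [map_sub] at this ⊢
  · have := S.form_swap_eq_zero hc h.swap t u v w
    rwa [map_sub] at this ⊢
  · have := S.form_balance_eq_zero hc h.balance t u v w a
    rwa [map_add, map_sub, map_sub] at this ⊢
  · exact S.form_gc3_eq_zero hc h.gc3 t u v w

/-- The form on the presentation space of `C₁₂` given by two coefficient systems. -/
def form₂ : Coef × Coef →ₗ[ℚ] P2 g →ₗ[ℚ] A where
  toFun p := (S.form p.1).coprod (S.form p.2)
  map_add' p q := by ext x <;> simp
  map_smul' r p := by ext x <;> simp

lemma form₂_apply (p : Coef × Coef) (x : P2 g) :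
    S.form₂ p x = S.form p.1 x.1 + S.form p.2 x.2 := rfl

lemma form₂_ThP (c d : Coef) (t u v w : TA g) :
    S.form₂ (c, d) (ThP g t u v w) = S.form c (Th g t u v w) := by
  rw [form₂_apply, ThP, map_zero, add_zero]

lemma form₂_DP (c d : Coef) (t u v w : TA g) :
    S.form₂ (c, d) (DP g t u v w) = S.form d (Th g t u v w) := by
  rw [form₂_apply, DP, map_zero, zero_add]

lemma form_cross_eq_zero (hc : c.Supported)
    (h : ∀ i j k l, i + j + k + l = 4 → c i j k l - c.cross S.ε i j k l = 0) (t u v w : TA g) :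
    S.form c (Th g t u v w) - S.form c (Th g (barT g v) u (barT g t) w) = 0 := by
  refine ((isLinear₄_map_Th (S.form c)).sub (isLinear₄_cross (S.form c))).eq_zero_of_word
    (fun L₁ L₂ L₃ L₄ => ?_) t u v w
  rw [S.form_word hc, S.form_cross hc, ← sub_smul]
  by_cases hl : L₁.length + L₂.length + L₃.length + L₄.length = 4
  · rw [h _ _ _ _ hl, zero_smul]
  · rw [hc _ _ _ _ hl, hc.cross _ hl, sub_zero, zero_smul]

lemma form_resolve_eq_zero (hc : c.Supported) (hd : d.Supported)
    (h : ∀ i j k l, i + j + k + l = 4 → d i j k l - c i j k l - c.cross S.ε i j k l = 0)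
    (t u v w : TA g) :
    S.form d (Th g t u v w) - S.form c (Th g t u v w) -
      S.form c (Th g (barT g v) u (barT g t) w) = 0 := by
  refine (((isLinear₄_map_Th (S.form d)).sub (isLinear₄_map_Th (S.form c))).sub
    (isLinear₄_cross (S.form c))).eq_zero_of_word (fun L₁ L₂ L₃ L₄ => ?_) t u v w
  rw [S.form_word hd, S.form_word hc, S.form_cross hc, ← sub_smul, ← sub_smul]
  by_cases hl : L₁.length + L₂.length + L₃.length + L₄.length = 4
  · rw [h _ _ _ _ hl, zero_smul]
  · rw [hd _ _ _ _ hl, hc _ _ _ _ hl, hc.cross _ hl, sub_zero, sub_zero, zero_smul]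

lemma form₂_C12Rel (h : c.IsC12 S.ε d) {x : P2 g} (hx : x ∈ C12Rel g) :
    S.form₂ (c, d) x = 0 := by
  have hc := h.supported
  have hd := h.supported'
  rcases mem_C12Rel.1 hx with ⟨t, u, v, w, rfl⟩ | ⟨t, u, v, w, rfl⟩ | ⟨t, u, v, w, rfl⟩ |
    ⟨t, u, v, w, rfl⟩ |
    ⟨t, u, v, w, a, rfl⟩ | ⟨t, u, v, w, a, rfl⟩ | ⟨t, u, v, w, rfl⟩
  · have := S.form_thetaFlip_eq_zero hc h.thetaFlip t u v w
    rw [map_sub] at this ⊢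
    rwa [form₂_ThP, form₂_ThP]
  · have := S.form_swap_eq_zero hc h.swap t u v w
    rw [map_sub] at this ⊢
    rwa [form₂_ThP, form₂_ThP]
  · rw [map_sub, form₂_DP, form₂_DP]
    exact S.form_cross_eq_zero hd h.cross t u v w
  · have := S.form_swap_eq_zero hd h.swap' t u v w
    rw [map_sub] at this ⊢
    rwa [form₂_DP, form₂_DP]
  · have := S.form_balance_eq_zero hc h.balance t u v w a
    rw [map_add, map_sub, map_sub] at this ⊢
    rwa [form₂_ThP, form₂_ThP, form₂_ThP, form₂_ThP]
  · have := S.form_balance_eq_zero hd h.balance' t u v w a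
    rw [map_add, map_sub, map_sub] at this ⊢
    rw [form₂_DP, form₂_DP, form₂_DP, form₂_DP, ← neg_eq_zero, ← this]
    abel
  · rw [map_sub, map_sub, form₂_DP, form₂_ThP, form₂_ThP]
    exact S.form_resolve_eq_zero hc hd h.resolve t u v w

end SignedModel

/-! ### Coefficients of forms vanishing on the relations -/

lemma barT_word_mem {g : ℕ} (L : List (Hsp g)) : barT g (word L) ∈ TAdeg g L.length := by
  rw [barT_word]
  exact Submodule.smul_mem _ _ (List.length_reverse (as := L) ▸ word_mem_TAdeg L.reverse)

lemma length_of_mem_splits {α : Type*} {L : List α} {P : List α × List α} (h : P ∈ splits L) :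
    P.1.length + P.2.length = L.length := by
  induction L generalizing P with
  | nil => simp_all [splits]
  | cons a L ih =>
    simp only [splits, List.mem_append, List.mem_map] at h
    rcases h with ⟨Q, hQ, rfl⟩ | ⟨Q, hQ, rfl⟩ <;> simp [← ih hQ] <;> omega

lemma Th_mem_T4deg {g i j k l m : ℕ} {t u v w : TA g} (ht : t ∈ TAdeg g i) (hu : u ∈ TAdeg g j)
    (hv : v ∈ TAdeg g k) (hw : w ∈ TAdeg g l) (h : i + j + k + l = m) :
    Th g t u v w ∈ T4deg g m :=
  Submodule.subset_span ⟨i, j, k, l, h, t, ht, u, hu, v, hv, w, hw, rfl⟩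

lemma Submodule.list_sum_map_mem {V α : Type*} [AddCommGroup V] [Module ℚ V] (M : Submodule ℚ V)
    {f : α → V} {l : List α} (h : ∀ a ∈ l, f a ∈ M) : (l.map f).sum ∈ M :=
  list_sum_mem fun x hx => by
    obtain ⟨a, ha, rfl⟩ := List.mem_map.1 hx
    exact h a ha

lemma gc3_word_mem {g m : ℕ} {L₁ L₂ L₃ L₄ : List (Hsp g)}
    (h : L₁.length + L₂.length + L₃.length + L₄.length = m) :
    gc3 g (word L₁) (word L₂) (word L₃) (word L₄) ∈ T4deg g m := by
  rw [gc3, gc3B_word, gc3C_word]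
  refine add_mem (add_mem (Th_word_mem_T4deg h) ?_) ?_ <;>
    refine Submodule.list_sum_map_mem _ fun P hP => Submodule.list_sum_map_mem _ fun Q hQ => ?_
  · refine Th_mem_T4deg (barT_word_mem _) (word_mem_TAdeg _) (barT_word_mem _) (word_mem_TAdeg _) ?_
    have := length_of_mem_splits hP
    have := length_of_mem_splits hQ
    simp only [List.length_append]
    omega
  · refine Th_mem_T4deg (word_mem_TAdeg _) (barT_word_mem _) (word_mem_TAdeg _) (barT_word_mem _) ?_
    have := length_of_mem_splits hP
    have := length_of_mem_splits hQ
    simp only [List.length_append]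
    omega

namespace SignedModel

variable {g : ℕ} {A : Type} [Ring A] [Algebra ℚ A] (S : SignedModel g A) {c d : Coef}

lemma exists_val₄_ne_zero (hS : ∃ L : List (Hsp g), L.length = 4 ∧ S.val L ≠ 0) {i j k l : ℕ}
    (h : i + j + k + l = 4) : ∃ L₁ L₂ L₃ L₄ : List (Hsp g), L₁.length = i ∧ L₂.length = j ∧
      L₃.length = k ∧ L₄.length = l ∧ S.val₄ L₁ L₂ L₃ L₄ ≠ 0 := by
  obtain ⟨L, hL, h0⟩ := hS
  obtain ⟨L₁, L₂, L₃, L₄, h₁, h₂, h₃, h₄, rfl⟩ := exists_append_eq L (hL.trans h.symm)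
  exact ⟨L₁, L₂, L₃, L₄, h₁, h₂, h₃, h₄, by simpa [val₄] using h0⟩

lemma exists_val₄_append_ne_zero (hS : ∃ L : List (Hsp g), L.length = 4 ∧ S.val L ≠ 0)
    {i j k l : ℕ} (h : i + j + k + l = 3) : ∃ (L₁ L₂ L₃ L₄ : List (Hsp g)) (a : Hsp g),
      L₁.length = i ∧ L₂.length = j ∧ L₃.length = k ∧ L₄.length = l ∧
        S.val₄ L₁ L₂ L₃ (L₄ ++ [a]) ≠ 0 := by
  obtain ⟨L₁, L₂, L₃, L, h₁, h₂, h₃, hL, h0⟩ :=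
    S.exists_val₄_ne_zero hS (i := i) (j := j) (k := k) (l := l + 1) (by omega)
  obtain ⟨L₄, a, rfl⟩ := (List.eq_nil_or_concat' L).resolve_left (by rintro rfl; simp at hL)
  exact ⟨L₁, L₂, L₃, L₄, a, h₁, h₂, h₃, by simpa using hL, h0⟩

lemma thetaFlip_eq_zero (hS : ∃ L : List (Hsp g), L.length = 4 ∧ S.val L ≠ 0) (hc : c.Supported)
    (h : ∀ t u v w : TA g,
      Th g t u v w - Th g (barT g v) (barT g w) (barT g t) (barT g u) ∈ T4deg g 4 →
      S.form c (Th g t u v w - Th g (barT g v) (barT g w) (barT g t) (barT g u)) = 0)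
    {i j k l : ℕ} (hs : i + j + k + l = 4) : c.thetaFlip S.ε i j k l = 0 := by
  obtain ⟨L₁, L₂, L₃, L₄, rfl, rfl, rfl, rfl, h0⟩ := S.exists_val₄_ne_zero hS hs
  refine (smul_eq_zero.1 ((S.form_thetaFlip hc L₁ L₂ L₃ L₄).symm.trans (h _ _ _ _ ?_))).resolve_right
    h0
  exact sub_mem (Th_word_mem_T4deg hs) (Th_mem_T4deg (barT_word_mem _) (barT_word_mem _)
    (barT_word_mem _) (barT_word_mem _) (by omega))

lemma swap_eq_zero (hS : ∃ L : List (Hsp g), L.length = 4 ∧ S.val L ≠ 0) (hc : c.Supported)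
    (h : ∀ t u v w : TA g,
      Th g t u v w - Th g (barT g u) (barT g t) (barT g w) (barT g v) ∈ T4deg g 4 →
      S.form c (Th g t u v w - Th g (barT g u) (barT g t) (barT g w) (barT g v)) = 0)
    {i j k l : ℕ} (hs : i + j + k + l = 4) : c.swap S.ε i j k l = 0 := by
  obtain ⟨L₁, L₂, L₃, L₄, rfl, rfl, rfl, rfl, h0⟩ := S.exists_val₄_ne_zero hS hs
  refine (smul_eq_zero.1 ((S.form_swap hc L₁ L₂ L₃ L₄).symm.trans (h _ _ _ _ ?_))).resolve_right h0
  exact sub_mem (Th_word_mem_T4deg hs) (Th_mem_T4deg (barT_word_mem _) (barT_word_mem _)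
    (barT_word_mem _) (barT_word_mem _) (by omega))

lemma balance_eq_zero (hS : ∃ L : List (Hsp g), L.length = 4 ∧ S.val L ≠ 0) (hc : c.Supported)
    (h : ∀ (t u v w : TA g) (a : Hsp g),
      Th g t u v (w * TensorAlgebra.ι ℚ a) - Th g t u (TensorAlgebra.ι ℚ a * v) w
        - Th g t (TensorAlgebra.ι ℚ a * u) v w + Th g (t * TensorAlgebra.ι ℚ a) u v w
        ∈ T4deg g 4 →
      S.form c (Th g t u v (w * TensorAlgebra.ι ℚ a) - Th g t u (TensorAlgebra.ι ℚ a * v) w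
        - Th g t (TensorAlgebra.ι ℚ a * u) v w + Th g (t * TensorAlgebra.ι ℚ a) u v w) = 0)
    {i j k l : ℕ} (hs : i + j + k + l = 3) : c.balance S.ε i j k l = 0 := by
  obtain ⟨L₁, L₂, L₃, L₄, a, rfl, rfl, rfl, rfl, h0⟩ := S.exists_val₄_append_ne_zero hS hs
  refine (smul_eq_zero.1 ((S.form_balance hc L₁ L₂ L₃ L₄ a).symm.trans
    (h _ _ _ _ _ ?_))).resolve_right h0
  simp only [word_mul_ι, ← word_cons]
  refine add_mem (sub_mem (sub_mem ?_ ?_) ?_) ?_ <;> refine Th_word_mem_T4deg ?_ <;>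
    simp only [List.length_append, List.length_cons, List.length_nil] <;> omega

lemma gc3_eq_zero (hS : ∃ L : List (Hsp g), L.length = 4 ∧ S.val L ≠ 0) (hc : c.Supported)
    (h : ∀ t u v w : TA g, gc3 g t u v w ∈ T4deg g 4 → S.form c (gc3 g t u v w) = 0)
    {i j k l : ℕ} (hs : i + j + k + l = 4) :
    c i j k l + c.unshuffleB S.ε i j k l + c.unshuffleC S.ε i j k l = 0 := by
  obtain ⟨L₁, L₂, L₃, L₄, rfl, rfl, rfl, rfl, h0⟩ := S.exists_val₄_ne_zero hS hs
  exact (smul_eq_zero.1 ((S.form_gc3 hc L₁ L₂ L₃ L₄).symm.trans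
    (h _ _ _ _ (gc3_word_mem hs)))).resolve_right h0

lemma isOmega_of_form (hS : ∃ L : List (Hsp g), L.length = 4 ∧ S.val L ≠ 0) (hc : c.Supported)
    (h : ∀ x ∈ OmegaRel g, x ∈ T4deg g 4 → S.form c x = 0) : c.IsOmega S.ε where
  supported := hc
  thetaFlip _ _ _ _ := S.thetaFlip_eq_zero hS hc fun t u v w =>
    h _ (mem_OmegaRel.2 (.inl ⟨t, u, v, w, rfl⟩))
  swap _ _ _ _ := S.swap_eq_zero hS hc fun t u v w =>
    h _ (mem_OmegaRel.2 (.inr (.inl ⟨t, u, v, w, rfl⟩)))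
  balance _ _ _ _ := S.balance_eq_zero hS hc fun t u v w a =>
    h _ (mem_OmegaRel.2 (.inr (.inr (.inl ⟨t, u, v, w, a, rfl⟩))))
  gc3 _ _ _ _ := S.gc3_eq_zero hS hc fun t u v w =>
    h _ (mem_OmegaRel.2 (.inr (.inr (.inr ⟨t, u, v, w, rfl⟩))))

lemma isC12_of_form₂ (hS : ∃ L : List (Hsp g), L.length = 4 ∧ S.val L ≠ 0) (hc : c.Supported)
    (hd : d.Supported)
    (h : ∀ x ∈ C12Rel g, x ∈ (T4deg g 4).prod (T4deg g 4) → S.form₂ (c, d) x = 0) :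
    c.IsC12 S.ε d where
  supported := hc
  supported' := hd
  thetaFlip _ _ _ _ := S.thetaFlip_eq_zero hS hc fun t u v w hx => by
    have := h _ (mem_C12Rel.2 (.inl ⟨t, u, v, w, rfl⟩))
    simp only [ThP, Prod.mk_sub_mk, sub_zero, form₂_apply, map_zero, add_zero] at this
    exact this ⟨hx, zero_mem _⟩
  swap _ _ _ _ := S.swap_eq_zero hS hc fun t u v w hx => by
    have := h _ (mem_C12Rel.2 (.inr (.inl ⟨t, u, v, w, rfl⟩)))
    simp only [ThP, Prod.mk_sub_mk, sub_zero, form₂_apply, map_zero, add_zero] at this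
    exact this ⟨hx, zero_mem _⟩
  cross i j k l hs := by
    obtain ⟨L₁, L₂, L₃, L₄, rfl, rfl, rfl, rfl, h0⟩ := S.exists_val₄_ne_zero hS hs
    have := h _ (mem_C12Rel.2 (.inr (.inr (.inl ⟨word L₁, word L₂, word L₃, word L₄, rfl⟩))))
    simp only [DP, Prod.mk_sub_mk, sub_zero, form₂_apply, map_zero, zero_add, map_sub,
      S.form_word hd, S.form_cross hd, ← sub_smul] at this
    refine (smul_eq_zero.1 (this ⟨zero_mem _, ?_⟩)).resolve_right h0
    exact sub_mem (Th_word_mem_T4deg hs) (Th_mem_T4deg (barT_word_mem _) (word_mem_TAdeg _)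
      (barT_word_mem _) (word_mem_TAdeg _) (by omega))
  swap' _ _ _ _ := S.swap_eq_zero hS hd fun t u v w hx => by
    have := h _ (mem_C12Rel.2 (.inr (.inr (.inr (.inl ⟨t, u, v, w, rfl⟩)))))
    simp only [DP, Prod.mk_sub_mk, sub_zero, form₂_apply, map_zero, zero_add] at this
    exact this ⟨zero_mem _, hx⟩
  balance _ _ _ _ := S.balance_eq_zero hS hc fun t u v w a hx => by
    have := h _ (mem_C12Rel.2 (.inr (.inr (.inr (.inr (.inl ⟨t, u, v, w, a, rfl⟩))))))
    simp only [ThP, Prod.mk_sub_mk, Prod.mk_add_mk, sub_zero, form₂_apply, map_zero,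
      add_zero] at this
    exact this ⟨hx, zero_mem _⟩
  balance' _ _ _ _ := S.balance_eq_zero hS hd fun t u v w a hx => by
    have := h _ (mem_C12Rel.2 (.inr (.inr (.inr (.inr (.inr (.inl ⟨t, u, v, w, a, rfl⟩)))))))
    have h' : ∀ p q r s : T4 g, q - s - p + r = -(p - q - r + s) := fun p q r s => by abel
    simp only [DP, Prod.mk_sub_mk, Prod.mk_add_mk, sub_zero, form₂_apply, map_zero,
      zero_add, add_zero] at this
    rw [h', map_neg, neg_eq_zero] at this
    exact this ⟨zero_mem _, neg_mem hx⟩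
  resolve i j k l hs := by
    obtain ⟨L₁, L₂, L₃, L₄, rfl, rfl, rfl, rfl, h0⟩ := S.exists_val₄_ne_zero hS hs
    have := h _ (mem_C12Rel.2 (.inr (.inr (.inr (.inr (.inr (.inr
      ⟨word L₁, word L₂, word L₃, word L₄, rfl⟩)))))))
    rw [map_sub, map_sub, form₂_DP, form₂_ThP, form₂_ThP, S.form_word hc, S.form_word hd,
      S.form_cross hc, ← sub_smul, ← sub_smul] at this
    refine (smul_eq_zero.1 (this (sub_mem (sub_mem ?_ ?_) ?_))).resolve_right h0
    · exact ⟨zero_mem _, Th_word_mem_T4deg hs⟩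
    · exact ⟨Th_word_mem_T4deg hs, zero_mem _⟩
    · exact ⟨Th_mem_T4deg (barT_word_mem _) (word_mem_TAdeg _) (barT_word_mem _)
        (word_mem_TAdeg _) (by omega), zero_mem _⟩

end SignedModel

/-! ### Dimension of the spaces of equivariant maps -/

/-- A space `E` of linear maps from the image of `D` in the quotient by the relations `R` has
dimension `n` if it is parametrized by `n` linearly independent forms killing the relations. -/
lemma finrank_eq_of_forms {P A : Type*} [AddCommGroup P] [Module ℚ P] [AddCommGroup A] [Module ℚ A]
    {R : Set P} {D : Submodule ℚ P} {M : Submodule ℚ A}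
    (E : Submodule ℚ (↥(D.map (Submodule.span ℚ R).mkQ) →ₗ[ℚ] ↥M)) {n : ℕ}
    (b : Fin n → P →ₗ[ℚ] A) (hR : ∀ m, ∀ x ∈ R, b m x = 0) (hM : ∀ m, ∀ x ∈ D, b m x ∈ M)
    (hE : ∀ m, ∀ π : ↥(D.map (Submodule.span ℚ R).mkQ) →ₗ[ℚ] ↥M,
      (∀ x hx, (π ⟨Submodule.Quotient.mk x, hx⟩ : A) = b m x) → π ∈ E)
    (hb : ∀ r : Fin n → ℚ, (∀ x ∈ D, ∑ m, r m • b m x = 0) → r = 0)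
    (hspan : ∀ π ∈ E, ∃ r : Fin n → ℚ, ∀ x (hx : x ∈ D),
      (π ⟨Submodule.Quotient.mk x, Submodule.mem_map_of_mem hx⟩ : A) = ∑ m, r m • b m x) :
    Module.finrank ℚ E = n := by
  have hker : ∀ m, Submodule.span ℚ R ≤ LinearMap.ker (b m) := fun m =>
    Submodule.span_le.2 (hR m)
  have hmem : ∀ m, ∀ y : ↥(D.map (Submodule.span ℚ R).mkQ),
      (Submodule.span ℚ R).liftQ (b m) (hker m) y ∈ M := by
    rintro m ⟨_, x, hx, rfl⟩
    exact hM m x hx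
  let β : Fin n → ↥(D.map (Submodule.span ℚ R).mkQ) →ₗ[ℚ] ↥M := fun m =>
    LinearMap.codRestrict M (((Submodule.span ℚ R).liftQ (b m) (hker m)).domRestrict _) (hmem m)
  have hβ : ∀ (r : Fin n → ℚ) x hx,
      ((∑ m, r m • β m) ⟨Submodule.Quotient.mk x, hx⟩ : A) = ∑ m, r m • b m x := fun r x hx => by
    simp only [LinearMap.sum_apply, LinearMap.smul_apply, Submodule.coe_sum, Submodule.coe_smul]
    rfl
  have hli : LinearIndependent ℚ β := by
    refine Fintype.linearIndependent_iff.2 fun r hr m => congrFun (hb r fun x hx => ?_) m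
    rw [← hβ r x (Submodule.mem_map_of_mem hx), hr]
    rfl
  have hE' : E = Submodule.span ℚ (Set.range β) := by
    refine le_antisymm (fun π hπ => ?_) (Submodule.span_le.2 ?_)
    · obtain ⟨r, hr⟩ := hspan π hπ
      have : π = ∑ m, r m • β m := by
        ext ⟨_, x, hx, rfl⟩
        exact (hr x hx).trans (hβ r x (Submodule.mem_map_of_mem hx)).symm
      rw [this]
      exact Submodule.sum_mem _ fun m _ => Submodule.smul_mem _ _ (Submodule.subset_span ⟨m, rfl⟩)
    · rintro _ ⟨m, rfl⟩
      exact hE m (β m) fun x hx => rfl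
  rw [hE', finrank_span_eq_card hli, Fintype.card_fin]

lemma T4map_mem_T4deg {g m : ℕ} (φ : Hsp g →ₗ[ℚ] Hsp g) {x : T4 g} (hx : x ∈ T4deg g m) :
    T4map g φ x ∈ T4deg g m := by
  rw [← Submodule.Quotient.mk_eq_zero]
  refine eq_zero_of_mem_T4deg (φ := (T4deg g m).mkQ ∘ₗ T4map g φ) (fun L₁ L₂ L₃ L₄ h => ?_) hx
  refine (Submodule.Quotient.mk_eq_zero _).2 ?_
  rw [T4map_Th, TAmap_word, TAmap_word, TAmap_word, TAmap_word]
  exact Th_word_mem_T4deg (by simpa using h)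

/-- Linear maps out of the image of `D` in a quotient come from the presentation space. -/
lemma exists_lift {P A : Type*} [AddCommGroup P] [Module ℚ P] [AddCommGroup A] [Module ℚ A]
    {N D : Submodule ℚ P} {M : Submodule ℚ A} (π : ↥(D.map N.mkQ) →ₗ[ℚ] ↥M) :
    ∃ Ψ : P →ₗ[ℚ] A, ∀ x (hx : x ∈ D),
      Ψ x = π ⟨Submodule.Quotient.mk x, Submodule.mem_map_of_mem hx⟩ := by
  obtain ⟨Ψ, hΨ⟩ := LinearMap.exists_extend (M.subtype ∘ₗ π ∘ₗ N.mkQ.submoduleMap D)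
  exact ⟨Ψ, fun x hx => LinearMap.congr_fun hΨ ⟨x, hx⟩⟩

/-- Evaluation of coefficients at four given lengths. -/
def Coef.at (c : Coef) (q : Fin 4 → ℕ) : ℚ := c (q 0) (q 1) (q 2) (q 3)

namespace SignedModel

variable {g : ℕ} {A : Type} [Ring A] [Algebra ℚ A] (S : SignedModel g A)

lemma eq_zero_of_sum_form (hS : ∃ L : List (Hsp g), L.length = 4 ∧ S.val L ≠ 0) {n : ℕ}
    {b : Fin n → Coef} {q : Fin n → Fin 4 → ℕ} (hb : ∀ m, (b m).Supported)
    (hq : ∀ m, q m 0 + q m 1 + q m 2 + q m 3 = 4)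
    (hbq : ∀ m m', (b m).at (q m') = if m = m' then 1 else 0) {r : Fin n → ℚ}
    (h : ∀ x ∈ T4deg g 4, ∑ m, r m • S.form (b m) x = 0) : r = 0 := by
  funext m'
  obtain ⟨L₁, L₂, L₃, L₄, h₁, h₂, h₃, h₄, h0⟩ := S.exists_val₄_ne_zero hS (hq m')
  have hl : L₁.length + L₂.length + L₃.length + L₄.length = 4 := by
    rw [h₁, h₂, h₃, h₄, hq m']
  have hsum := h _ (Th_word_mem_T4deg hl)
  simp only [S.form_word (hb _), h₁, h₂, h₃, h₄, smul_smul, ← Finset.sum_smul] at hsum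
  have := (smul_eq_zero.1 hsum).resolve_right h0
  change ∑ m, r m * (b m).at (q m') = 0 at this
  simpa [hbq] using this

/-- The dimension of the space of equivariant maps from `Ω̃₂` is the number of solutions of the
numerical relations. -/
lemma finrank_omega (hg : 4 ≤ g) (hS : ∃ L : List (Hsp g), L.length = 4 ∧ S.val L ≠ 0)
    {M : Submodule ℚ A} (hM : M = LinearMap.range S.ℓ ^ 4)
    (E : Submodule ℚ (↥(Omega2deg g 4) →ₗ[ℚ] ↥M))
    (hE : ∀ π, π ∈ E ↔ ∀ (σ : Hsp g ≃ₗ[ℚ] Hsp g) (x : T4 g)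
      (hx : Submodule.Quotient.mk x ∈ Omega2deg g 4)
      (hy : Submodule.Quotient.mk (T4map g σ.toLinearMap x) ∈ Omega2deg g 4),
      (π ⟨Submodule.Quotient.mk (T4map g σ.toLinearMap x), hy⟩ : A) =
        S.act σ (π ⟨Submodule.Quotient.mk x, hx⟩))
    {n : ℕ} {b : Fin n → Coef} {q : Fin n → Fin 4 → ℕ} (hb : ∀ m, (b m).IsOmega S.ε)
    (hq : ∀ m, q m 0 + q m 1 + q m 2 + q m 3 = 4)
    (hbq : ∀ m m', (b m).at (q m') = if m = m' then 1 else 0)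
    (hspan : ∀ c : Coef, c.IsOmega S.ε → c = ∑ m, c.at (q m) • b m) :
    Module.finrank ℚ E = n := by
  subst hM
  refine finrank_eq_of_forms E (fun m => S.form (b m)) (fun m x => S.form_OmegaRel (hb m))
    (fun m x => S.form_mem (hb m).supported) (fun m π h => (hE π).2 fun σ x hx hy => ?_)
    (fun r => S.eq_zero_of_sum_form hS (fun m => (hb m).supported) hq hbq) fun π hπ => ?_
  · exact ((h _ hy).trans (S.form_T4map (hb m).supported σ x)).trans
      (congrArg (S.act σ) (h x hx).symm)
  · obtain ⟨Ψ, hΨ⟩ := exists_lift π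
    obtain ⟨c, hc, hΨc⟩ := S.exists_form_eq hg (Ψ := Ψ) (fun x hx => hΨ x hx ▸ Subtype.prop _)
      fun σ x hx => by
        rw [hΨ x hx, hΨ _ (T4map_mem_T4deg _ hx)]
        exact (hE π).1 hπ σ x _ _
    have hR : c.IsOmega S.ε := S.isOmega_of_form hS hc fun x hx hx' => by
      have : (⟨Submodule.Quotient.mk x, Submodule.mem_map_of_mem hx'⟩ : ↥(Omega2deg g 4)) = 0 :=
        Subtype.ext ((Submodule.Quotient.mk_eq_zero _).2 (Submodule.subset_span hx))
      rw [← hΨc x hx', hΨ x hx']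
      exact congrArg Subtype.val ((congrArg π this).trans (map_zero π))
    refine ⟨fun m => c.at (q m), fun x hx => ?_⟩
    rw [← hΨ x hx, hΨc x hx]
    conv_lhs => rw [hspan c hR]
    simp only [map_sum, map_smul, LinearMap.sum_apply, LinearMap.smul_apply]

lemma form₂_P2map {c d : Coef} (hc : c.Supported) (hd : d.Supported) (σ : Hsp g ≃ₗ[ℚ] Hsp g)
    (x : P2 g) : S.form₂ (c, d) (P2map g σ.toLinearMap x) = S.act σ (S.form₂ (c, d) x) := by
  rw [form₂_apply, form₂_apply, map_add, ← S.form_T4map hc, ← S.form_T4map hd]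
  rfl

set_option maxHeartbeats 1000000 in
/-- The dimension of the space of equivariant maps from `C₁₂` is the number of solutions of the
numerical relations. -/
lemma finrank_C12 (hg : 4 ≤ g) (hS : ∃ L : List (Hsp g), L.length = 4 ∧ S.val L ≠ 0)
    {M : Submodule ℚ A} (hM : M = LinearMap.range S.ℓ ^ 4)
    (E : Submodule ℚ (↥(C12deg g 4) →ₗ[ℚ] ↥M))
    (hE : ∀ π, π ∈ E ↔ ∀ (σ : Hsp g ≃ₗ[ℚ] Hsp g) (x : P2 g)
      (hx : Submodule.Quotient.mk x ∈ C12deg g 4)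
      (hy : Submodule.Quotient.mk (P2map g σ.toLinearMap x) ∈ C12deg g 4),
      (π ⟨Submodule.Quotient.mk (P2map g σ.toLinearMap x), hy⟩ : A) =
        S.act σ (π ⟨Submodule.Quotient.mk x, hx⟩))
    {n : ℕ} {b b' : Fin n → Coef} {q : Fin n → Fin 4 → ℕ} (hb : ∀ m, (b m).IsC12 S.ε (b' m))
    (hq : ∀ m, q m 0 + q m 1 + q m 2 + q m 3 = 4)
    (hbq : ∀ m m', (b m).at (q m') = if m = m' then 1 else 0)
    (hspan : ∀ c d : Coef, c.IsC12 S.ε d →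
      c = ∑ m, c.at (q m) • b m ∧ d = ∑ m, c.at (q m) • b' m) :
    Module.finrank ℚ E = n := by
  subst hM
  have hP : ∀ σ : Hsp g ≃ₗ[ℚ] Hsp g, ∀ x ∈ (T4deg g 4).prod (T4deg g 4),
      P2map g σ.toLinearMap x ∈ (T4deg g 4).prod (T4deg g 4) := fun σ x hx =>
    ⟨T4map_mem_T4deg _ hx.1, T4map_mem_T4deg _ hx.2⟩
  refine finrank_eq_of_forms E (fun m => S.form₂ (b m, b' m)) (fun m x => S.form₂_C12Rel (hb m))
    (fun m x hx => add_mem (S.form_mem (hb m).supported hx.1) (S.form_mem (hb m).supported' hx.2))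
    (fun m π h => (hE π).2 fun σ x hx hy => ?_) (fun r hr => ?_) fun π hπ => ?_
  · exact ((h _ hy).trans (S.form₂_P2map (hb m).supported (hb m).supported' σ x)).trans
      (congrArg (S.act σ) (h x hx).symm)
  · refine S.eq_zero_of_sum_form hS (fun m => (hb m).supported) hq hbq fun x hx => ?_
    simpa [form₂_apply] using hr (x, 0) ⟨hx, zero_mem _⟩
  · obtain ⟨Ψ, hΨ⟩ := exists_lift π
    have hΨM : ∀ x ∈ (T4deg g 4).prod (T4deg g 4), Ψ x ∈ LinearMap.range S.ℓ ^ 4 :=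
      fun x hx => hΨ x hx ▸ Subtype.prop _
    have hΨσ : ∀ σ : Hsp g ≃ₗ[ℚ] Hsp g, ∀ x ∈ (T4deg g 4).prod (T4deg g 4),
        Ψ (P2map g σ.toLinearMap x) = S.act σ (Ψ x) := fun σ x hx => by
      rw [hΨ x hx, hΨ _ (hP σ x hx)]
      exact (hE π).1 hπ σ x _ _
    obtain ⟨c, hc, hΨc⟩ := S.exists_form_eq hg (Ψ := Ψ ∘ₗ LinearMap.inl ℚ _ _)
      (fun x hx => hΨM (x, 0) ⟨hx, zero_mem _⟩)
      fun σ x hx => by simpa [P2map] using hΨσ σ (x, 0) ⟨hx, zero_mem _⟩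
    obtain ⟨d, hd, hΨd⟩ := S.exists_form_eq hg (Ψ := Ψ ∘ₗ LinearMap.inr ℚ _ _)
      (fun x hx => hΨM (0, x) ⟨zero_mem _, hx⟩)
      fun σ x hx => by simpa [P2map] using hΨσ σ (0, x) ⟨zero_mem _, hx⟩
    have hΨ₂ : ∀ x ∈ (T4deg g 4).prod (T4deg g 4), Ψ x = S.form₂ (c, d) x := fun x hx => by
      rw [form₂_apply, ← hΨc _ hx.1, ← hΨd _ hx.2, LinearMap.comp_apply, LinearMap.comp_apply,
        ← map_add]
      simp
    have hR : c.IsC12 S.ε d := S.isC12_of_form₂ hS hc hd fun x hx hx' => by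
      have : (⟨Submodule.Quotient.mk x, Submodule.mem_map_of_mem hx'⟩ : ↥(C12deg g 4)) = 0 :=
        Subtype.ext ((Submodule.Quotient.mk_eq_zero _).2 (Submodule.subset_span hx))
      rw [← hΨ₂ x hx', hΨ x hx']
      exact congrArg Subtype.val ((congrArg π this).trans (map_zero π))
    refine ⟨fun m => c.at (q m), fun x hx => ?_⟩
    have hcd : (c, d) = ∑ m, c.at (q m) • (b m, b' m) := by
      ext1
      · simpa [Prod.fst_sum] using (hspan c d hR).1
      · simpa [Prod.snd_sum] using (hspan c d hR).2
    rw [← hΨ x hx, hΨ₂ x hx, hcd]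
    simp only [map_sum, map_smul, LinearMap.sum_apply, LinearMap.smul_apply]

end SignedModel

/-! ### Solutions of the numerical relations -/

namespace Coef

/-- The solution of the hair balancing relation with values `T` when the last slot is empty. -/
def ofTable (ε : ℚ) (T : List (List ℚ)) : Coef
  | i, j, k, 0 => if i + j + k = 4 then (T.getD i []).getD j 0 else 0
  | i, j, k, l + 1 => ε ^ (k + l) * ofTable ε T i j (k + 1) l
      + ε ^ (j + k + l) * (ofTable ε T i (j + 1) k l - ofTable ε T (i + 1) j k l)

lemma ofTable_supported (ε : ℚ) (T : List (List ℚ)) : (ofTable ε T).Supported := by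
  intro i j k l h
  induction l generalizing i j k with
  | zero => exact if_neg h
  | succ l ih =>
    rw [ofTable, ih i j (k + 1) (by omega), ih i (j + 1) k (by omega), ih (i + 1) j k (by omega)]
    ring

lemma ofTable_balance (ε : ℚ) (T : List (List ℚ)) (i j k l : ℕ) :
    (ofTable ε T).balance ε i j k l = 0 := by
  rw [balance, ofTable]
  ring

/-- The hair balancing relation moves letters out of the last slot. -/
lemma Supported.move_last {ε : ℚ} {c : Coef} (hc : c.Supported)
    (h : ∀ i j k l, i + j + k + l = 3 → c.balance ε i j k l = 0) (i j k l : ℕ) :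
    c i j k (l + 1) = ε ^ (k + l) * c i j (k + 1) l
      + ε ^ (j + k + l) * (c i (j + 1) k l - c (i + 1) j k l) := by
  have hb : c.balance ε i j k l = 0 := by
    by_cases hs : i + j + k + l = 3
    · exact h i j k l hs
    · exact hc.balance ε hs
  rw [Coef.balance] at hb
  linear_combination hb

/-- A balanced coefficient system is determined by its values when the last slot is empty. -/
lemma eq_sum_of_balance {ε : ℚ} {c : Coef} (hc : c.Supported)
    (h : ∀ i j k l, i + j + k + l = 3 → c.balance ε i j k l = 0) {n : ℕ} {r : Fin n → ℚ}
    {T : Fin n → List (List ℚ)}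
    (h0 : ∀ i < 5, ∀ j < 5, ∀ k < 5, i + j + k = 4 →
      c i j k 0 = ∑ m, r m * ofTable ε (T m) i j k 0) :
    c = ∑ m, r m • ofTable ε (T m) := by
  suffices ∀ l i j k, c i j k l = ∑ m, r m * ofTable ε (T m) i j k l by
    funext i j k l
    simpa [Finset.sum_apply] using this l i j k
  intro l
  induction l with
  | zero =>
    intro i j k
    by_cases hs : i + j + k = 4
    · exact h0 i (by omega) j (by omega) k (by omega) hs
    · simp [hc i j k 0 hs, ofTable, hs]
  | succ l ih =>
    intro i j k
    have hsum : ∑ m, r m * ofTable ε (T m) i j k (l + 1) =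
        ε ^ (k + l) * ∑ m, r m * ofTable ε (T m) i j (k + 1) l
          + ε ^ (j + k + l) * (∑ m, r m * ofTable ε (T m) i (j + 1) k l
            - ∑ m, r m * ofTable ε (T m) (i + 1) j k l) := by
      simp only [Finset.mul_sum, ← Finset.sum_sub_distrib, ← Finset.sum_add_distrib]
      exact Finset.sum_congr rfl fun m _ => by rw [ofTable]; ring
    rw [hsum, ← ih, ← ih, ← ih, hc.move_last h]

/-- Values of the two solutions of the relations of `Ω̃₂` in the symmetric case. -/
def omegaSymTable : Fin 2 → List (List ℚ) :=
  ![[[0, 1, 4/3, 1, 0], [0, 1, 4/3, 1], [0, 1, 4/3], [0, 1], [0]],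
    [[1, 0, -2/3, 0, 1], [1, 0, -2/3, 0], [1, 0, -2/3], [1, 0], [1]]]

/-- Values of the two solutions of the relations of `Ω̃₂` in the exterior case. -/
def omegaExtTable : Fin 2 → List (List ℚ) :=
  ![[[0, 1, 0, -1, 0], [0, -3/5, -2/5, 1], [0, -3/5, 0], [0, 1], [0]],
    [[1, -2, 2, 2, 1], [-1, 16/5, 4/5, 0], [1, 6/5, 2], [-1, 0], [1]]]

/-- Values of the six solutions of the relations of `C₁₂` in the symmetric case. -/
def thetaSymTable : Fin 6 → List (List ℚ) :=
  ![[[0, 0, 1, 0, 0], [0, 1, 0, 0], [1, 0, 0], [0, 0], [0]],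
    [[0, 0, 2, 0, 0], [0, 1, 1, 0], [0, 1, 0], [0, 0], [0]],
    [[0, 0, 1, 0, 0], [0, 0, 1, 0], [0, 0, 1], [0, 0], [0]],
    [[0, 1, -2, 1, 0], [1, -1, 0, 0], [0, 0, 0], [1, 0], [0]],
    [[0, 1, -2, 1, 0], [0, 0, -1, 1], [0, 0, 0], [0, 1], [0]],
    [[1, -1, 1, -1, 1], [0, 0, 0, 0], [0, 0, 0], [0, 0], [1]]]

/-- The relations of degree four can be checked on finitely many lengths. -/
lemma forall_of_lt {p : ℕ → ℕ → ℕ → ℕ → Prop}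
    (h : ∀ i j k l : Fin 5, (i + j + k + l : ℕ) = 4 → p i j k l) :
    ∀ i j k l, i + j + k + l = 4 → p i j k l := fun i j k l hs =>
  h ⟨i, by omega⟩ ⟨j, by omega⟩ ⟨k, by omega⟩ ⟨l, by omega⟩ hs

lemma isOmega_ofTable {ε : ℚ} {T : List (List ℚ)}
    (h : ∀ i j k l : Fin 5, (i + j + k + l : ℕ) = 4 →
      (ofTable ε T).thetaFlip ε i j k l = 0 ∧ (ofTable ε T).swap ε i j k l = 0 ∧
      ofTable ε T i j k l + (ofTable ε T).unshuffleB ε i j k l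
        + (ofTable ε T).unshuffleC ε i j k l = 0) : (ofTable ε T).IsOmega ε where
  supported := ofTable_supported ε T
  thetaFlip := forall_of_lt fun i j k l hs => (h i j k l hs).1
  swap := forall_of_lt fun i j k l hs => (h i j k l hs).2.1
  balance i j k l _ := ofTable_balance ε T i j k l
  gc3 := forall_of_lt fun i j k l hs => (h i j k l hs).2.2

lemma isOmega_omegaSymTable (m : Fin 2) : (ofTable 1 (omegaSymTable m)).IsOmega 1 := by
  refine isOmega_ofTable ?_
  revert m
  decide +kernel

lemma isOmega_omegaExtTable (m : Fin 2) : (ofTable (-1) (omegaExtTable m)).IsOmega (-1) := by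
  refine isOmega_ofTable ?_
  revert m
  decide +kernel

/-- The dumbbell coefficients determined by the theta coefficients. -/
def resolved (ε : ℚ) (c : Coef) : Coef := fun i j k l => c i j k l + c.cross ε i j k l

lemma isC12_ofTable {ε : ℚ} {T : List (List ℚ)}
    (h : ∀ i j k l : Fin 5, (i + j + k + l : ℕ) = 4 →
      (ofTable ε T).thetaFlip ε i j k l = 0 ∧ (ofTable ε T).swap ε i j k l = 0 ∧
      (ofTable ε T).resolved ε i j k l - ((ofTable ε T).resolved ε).cross ε i j k l = 0 ∧
      ((ofTable ε T).resolved ε).swap ε i j k l = 0)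
    (h' : ∀ i j k l : Fin 5, (i + j + k + l : ℕ) = 3 →
      ((ofTable ε T).resolved ε).balance ε i j k l = 0) :
    (ofTable ε T).IsC12 ε ((ofTable ε T).resolved ε) where
  supported := ofTable_supported ε T
  supported' i j k l hs := by
    rw [resolved, ofTable_supported ε T i j k l hs, (ofTable_supported ε T).cross ε hs, add_zero]
  thetaFlip := forall_of_lt fun i j k l hs => (h i j k l hs).1
  swap := forall_of_lt fun i j k l hs => (h i j k l hs).2.1
  cross := forall_of_lt fun i j k l hs => (h i j k l hs).2.2.1
  swap' := forall_of_lt fun i j k l hs => (h i j k l hs).2.2.2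
  balance i j k l _ := ofTable_balance ε T i j k l
  balance' i j k l hs := h' ⟨i, by omega⟩ ⟨j, by omega⟩ ⟨k, by omega⟩ ⟨l, by omega⟩ hs
  resolve i j k l _ := by
    rw [resolved]
    ring

lemma isC12_thetaSymTable (m : Fin 6) :
    (ofTable 1 (thetaSymTable m)).IsC12 1 ((ofTable 1 (thetaSymTable m)).resolved 1) := by
  refine isC12_ofTable ?_ ?_ <;> revert m <;> decide +kernel

/-- Lengths of the slots at which a solution of the relations of `Ω̃₂` is free. -/
def omegaFree : Fin 2 → Fin 4 → ℕ := ![![3, 1, 0, 0], ![4, 0, 0, 0]]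

/-- Lengths of the slots at which a solution of the relations of `C₁₂` is free. -/
def thetaFree : Fin 6 → Fin 4 → ℕ :=
  ![![2, 0, 2, 0], ![2, 1, 1, 0], ![2, 2, 0, 0], ![3, 0, 1, 0], ![3, 1, 0, 0], ![4, 0, 0, 0]]

lemma IsOmega.eq_sum_sym {c : Coef} (h : c.IsOmega 1) :
    c = ∑ m, c.at (omegaFree m) • ofTable 1 (omegaSymTable m) := by
  refine eq_sum_of_balance h.supported h.balance ?_
  have e₁ := h.thetaFlip 4 0 0 0 rfl
  have e₂ := h.swap 4 0 0 0 rfl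
  have e₃ := h.thetaFlip 3 1 0 0 rfl
  have e₄ := h.swap 3 1 0 0 rfl
  have e₅ := h.thetaFlip 2 2 0 0 rfl
  have e₆ := h.thetaFlip 1 3 0 0 rfl
  have e₇ := h.thetaFlip 3 0 1 0 rfl
  have e₈ := h.swap 3 0 1 0 rfl
  have e₉ := h.thetaFlip 2 1 1 0 rfl
  have f₁ := h.gc3 4 0 0 0 rfl
  have f₂ := h.gc3 3 0 1 0 rfl
  have f₃ := h.gc3 2 0 2 0 rfl
  have f₄ := h.gc3 0 2 2 0 rfl
  have hl := h.supported.move_last h.balance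
  norm_num [Coef.thetaFlip, Coef.swap, unshuffleB, unshuffleC, unshuffleSum, antipodeSign, hl]
    at e₁ e₂ e₃ e₄ e₅ e₆ e₇ e₈ e₉ f₁ f₂ f₃ f₄
  have r₀ : c.at (omegaFree 0) = c 3 1 0 0 := rfl
  have r₁ : c.at (omegaFree 1) = c 4 0 0 0 := rfl
  intro i hi j hj k hk hs
  simp only [Fin.sum_univ_two, r₀, r₁]
  interval_cases i <;> interval_cases j <;> try omega
  all_goals
    interval_cases k <;> first | omega | norm_num [omegaSymTable, ofTable]
  all_goals linarith

lemma IsOmega.eq_sum_ext {c : Coef} (h : c.IsOmega (-1)) :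
    c = ∑ m, c.at (omegaFree m) • ofTable (-1) (omegaExtTable m) := by
  refine eq_sum_of_balance h.supported h.balance ?_
  have e₁ := h.thetaFlip 4 0 0 0 rfl
  have e₂ := h.swap 4 0 0 0 rfl
  have e₃ := h.thetaFlip 3 1 0 0 rfl
  have e₄ := h.swap 3 1 0 0 rfl
  have e₅ := h.thetaFlip 2 2 0 0 rfl
  have e₆ := h.thetaFlip 1 3 0 0 rfl
  have e₇ := h.thetaFlip 3 0 1 0 rfl
  have e₈ := h.swap 3 0 1 0 rfl
  have e₉ := h.thetaFlip 2 1 1 0 rfl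
  have f₁ := h.gc3 4 0 0 0 rfl
  have f₂ := h.gc3 3 0 1 0 rfl
  have f₃ := h.gc3 2 0 2 0 rfl
  have f₄ := h.gc3 1 1 1 1 rfl
  have hl := h.supported.move_last h.balance
  norm_num [Coef.thetaFlip, Coef.swap, unshuffleB, unshuffleC, unshuffleSum, antipodeSign, hl]
    at e₁ e₂ e₃ e₄ e₅ e₆ e₇ e₈ e₉ f₁ f₂ f₃ f₄
  have r₀ : c.at (omegaFree 0) = c 3 1 0 0 := rfl
  have r₁ : c.at (omegaFree 1) = c 4 0 0 0 := rfl
  intro i hi j hj k hk hs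
  simp only [Fin.sum_univ_two, r₀, r₁]
  interval_cases i <;> interval_cases j <;> try omega
  all_goals
    interval_cases k <;> first | omega | norm_num [omegaExtTable, ofTable]
  all_goals linarith

lemma IsC12.eq_sum_sym {c d : Coef} (h : c.IsC12 1 d) :
    c = ∑ m, c.at (thetaFree m) • ofTable 1 (thetaSymTable m) := by
  refine eq_sum_of_balance h.supported h.balance ?_
  have e₁ := h.thetaFlip 4 0 0 0 rfl
  have e₂ := h.swap 4 0 0 0 rfl
  have e₃ := h.thetaFlip 3 1 0 0 rfl
  have e₄ := h.swap 3 1 0 0 rfl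
  have e₅ := h.thetaFlip 2 2 0 0 rfl
  have e₆ := h.thetaFlip 1 3 0 0 rfl
  have e₇ := h.thetaFlip 3 0 1 0 rfl
  have e₈ := h.swap 3 0 1 0 rfl
  have e₉ := h.thetaFlip 2 1 1 0 rfl
  have hl := h.supported.move_last h.balance
  norm_num [Coef.thetaFlip, Coef.swap, antipodeSign, hl] at e₁ e₂ e₃ e₄ e₅ e₆ e₇ e₈ e₉
  have r₀ : c.at (thetaFree 0) = c 2 0 2 0 := rfl
  have r₁ : c.at (thetaFree 1) = c 2 1 1 0 := rfl
  have r₂ : c.at (thetaFree 2) = c 2 2 0 0 := rfl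
  have r₃ : c.at (thetaFree 3) = c 3 0 1 0 := rfl
  have r₄ : c.at (thetaFree 4) = c 3 1 0 0 := rfl
  have r₅ : c.at (thetaFree 5) = c 4 0 0 0 := rfl
  intro i hi j hj k hk hs
  simp only [Fin.sum_univ_six, r₀, r₁, r₂, r₃, r₄, r₅]
  interval_cases i <;> interval_cases j <;> try omega
  all_goals
    interval_cases k <;> first | omega | simp [thetaSymTable, ofTable]
  all_goals linarith

lemma IsC12.eq_resolved {ε : ℚ} {c d : Coef} (h : c.IsC12 ε d) : d = c.resolved ε := by
  funext i j k l
  by_cases hs : i + j + k + l = 4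
  · have := h.resolve i j k l hs
    rw [resolved]
    linear_combination this
  · rw [h.supported' i j k l hs, resolved, h.supported i j k l hs, h.supported.cross ε hs,
      add_zero]

lemma resolved_sum (ε : ℚ) {n : ℕ} (r : Fin n → ℚ) (b : Fin n → Coef) :
    resolved ε (∑ m, r m • b m) = ∑ m, r m • resolved ε (b m) := by
  funext i j k l
  simp only [resolved, Coef.cross, Finset.sum_apply, Pi.smul_apply, smul_eq_mul, mul_add,
    Finset.sum_add_distrib, Finset.mul_sum, mul_left_comm]

lemma IsC12.eq_sum_sym' {c d : Coef} (h : c.IsC12 1 d) :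
    d = ∑ m, c.at (thetaFree m) • (ofTable 1 (thetaSymTable m)).resolved 1 := by
  rw [← resolved_sum, ← h.eq_sum_sym, h.eq_resolved]

lemma ofTable_omegaSymTable_at : ∀ m m' : Fin 2,
    (ofTable 1 (omegaSymTable m)).at (omegaFree m') = if m = m' then 1 else 0 := by
  decide +kernel

lemma ofTable_omegaExtTable_at : ∀ m m' : Fin 2,
    (ofTable (-1) (omegaExtTable m)).at (omegaFree m') = if m = m' then 1 else 0 := by
  decide +kernel

lemma ofTable_thetaSymTable_at : ∀ m m' : Fin 6,
    (ofTable 1 (thetaSymTable m)).at (thetaFree m') = if m = m' then 1 else 0 := by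
  decide +kernel

end Coef

/-! ### The symmetric and exterior algebras -/

/-- The inclusion of `H` in its symmetric algebra. -/
def linearPolynomial (g : ℕ) : Hsp g →ₗ[ℚ] MvPolynomial (Fin (2 * g)) ℚ :=
  Fintype.linearCombination ℚ MvPolynomial.X

lemma linearPolynomial_single (g : ℕ) (i : Fin (2 * g)) :
    linearPolynomial g (Pi.single i 1) = MvPolynomial.X i := by
  simp [linearPolynomial]

lemma polyAct_linearPolynomial (g : ℕ) (σ : Hsp g ≃ₗ[ℚ] Hsp g) (u : Hsp g) :
    polyAct g σ (linearPolynomial g u) = linearPolynomial g (σ u) := by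
  suffices (polyAct g σ).toLinearMap ∘ₗ linearPolynomial g =
      linearPolynomial g ∘ₗ σ.toLinearMap from LinearMap.congr_fun this u
  refine LinearMap.pi_ext' fun i => LinearMap.ext_ring ?_
  change polyAct g σ (linearPolynomial g (Pi.single i 1)) = linearPolynomial g (σ (Pi.single i 1))
  rw [linearPolynomial_single, polyAct, MvPolynomial.aeval_X]
  simp only [linearPolynomial, Fintype.linearCombination_apply, MvPolynomial.smul_eq_C_mul]

/-- The symmetric algebra of `H` as a signed model. -/
def symModel (g : ℕ) : SignedModel g (MvPolynomial (Fin (2 * g)) ℚ) where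
  ε := 1
  ℓ := linearPolynomial g
  act := polyAct g
  sq_ε := one_mul 1
  comm _ _ := (mul_comm _ _).trans (one_smul ℚ _).symm
  act_ℓ := polyAct_linearPolynomial g

/-- The exterior algebra of `H` as a signed model. -/
def extModel (g : ℕ) : SignedModel g (ExteriorAlgebra ℚ (Hsp g)) where
  ε := -1
  ℓ := ExteriorAlgebra.ι ℚ
  act σ := ExteriorAlgebra.map σ.toLinearMap
  sq_ε := by norm_num
  comm x y := by
    rw [neg_one_smul, eq_neg_iff_add_eq_zero]
    exact ExteriorAlgebra.ι_add_mul_swap x y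
  act_ℓ σ x := ExteriorAlgebra.map_apply_ι _ x

lemma homogeneousSubmodule_eq_range_pow (g m : ℕ) :
    MvPolynomial.homogeneousSubmodule (Fin (2 * g)) ℚ m =
      LinearMap.range (symModel g).ℓ ^ m := by
  rw [← MvPolynomial.homogeneousSubmodule_one_pow,
    MvPolynomial.homogeneousSubmodule_one_eq_span_X]
  congr 1
  exact (Fintype.range_linearCombination ℚ _).symm

lemma symModel_val_ne_zero {g : ℕ} (hg : 4 ≤ g) :
    ∃ L : List (Hsp g), L.length = 4 ∧ (symModel g).val L ≠ 0 := by
  refine ⟨List.replicate 4 (Pi.single ⟨0, by omega⟩ 1), List.length_replicate, ?_⟩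
  rw [SignedModel.val, List.map_replicate, List.prod_replicate]
  refine pow_ne_zero 4 ?_
  change linearPolynomial g _ ≠ 0
  rw [linearPolynomial_single]
  exact MvPolynomial.X_ne_zero _

lemma extModel_val_ne_zero {g : ℕ} (hg : 4 ≤ g) :
    ∃ L : List (Hsp g), L.length = 4 ∧ (extModel g).val L ≠ 0 := by
  let s := Set.powersetCard.ofFinEmbEquiv (Fin.castLEOrderEmb (show 4 ≤ 2 * g by omega))
  let v := Pi.basisFun ℚ (Fin (2 * g)) ∘ Set.powersetCard.ofFinEmbEquiv.symm s
  refine ⟨List.ofFn v, List.length_ofFn, fun h => ?_⟩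
  rw [SignedModel.val, List.map_ofFn] at h
  refine (exteriorPower.ιMulti_family_linearIndependent_ofBasis ℚ 4
    (Pi.basisFun ℚ (Fin (2 * g)))).ne_zero s (Subtype.ext ?_)
  exact (ExteriorAlgebra.ιMulti_apply v).trans h

/-- The multiplicities of `[4]` and `[1⁴]` in the `n = 6` row of Proposition 4.1:
stably, the space of `GL(H)`-equivariant maps `C₁₂^{(4)} → Sym⁴H` has dimension `6`,
the space of equivariant maps `Ω̃₂^{(4)} → Sym⁴H` has dimension `2`, and the space of
equivariant maps `Ω̃₂^{(4)} → Λ⁴H` has dimension `2`. -/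
theorem degree6_multiplicities :
    ∃ G : ℕ, 1 ≤ G ∧ ∀ g : ℕ, G ≤ g →
      Module.finrank ℚ ↥(equivC12toSym g 4 4) = 6 ∧
      Module.finrank ℚ ↥(equivOmega2toSym g 4 4) = 2 ∧
      Module.finrank ℚ ↥(equivOmega2toLam g 4 4) = 2 := by
  refine ⟨4, by norm_num, fun g hg => ⟨?_, ?_, ?_⟩⟩
  · exact (symModel g).finrank_C12 hg (symModel_val_ne_zero hg)
      (homogeneousSubmodule_eq_range_pow g 4) _ (fun _ => Iff.rfl) Coef.isC12_thetaSymTable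
      (by decide) Coef.ofTable_thetaSymTable_at fun c d h => ⟨h.eq_sum_sym, h.eq_sum_sym'⟩
  · exact (symModel g).finrank_omega hg (symModel_val_ne_zero hg)
      (homogeneousSubmodule_eq_range_pow g 4) _ (fun _ => Iff.rfl) Coef.isOmega_omegaSymTable
      (by decide) Coef.ofTable_omegaSymTable_at fun c h => h.eq_sum_sym
  · exact (extModel g).finrank_omega hg (extModel_val_ne_zero hg) rfl _ (fun _ => Iff.rfl)
      Coef.isOmega_omegaExtTable (by decide) Coef.ofTable_omegaExtTable_at
      fun c h => h.eq_sum_ext
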